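/- There is an absolute constant C > 0 such that the following holds. Let G be a finite abelian group, A ⊆ G, let B be a Bohr system on G with dim B ≤ d for some d ≥ 1, let f : G → ℂ, and let δ, κ ∈ (0,1] and p ≥ 2 be parameters. Then there exist a Bohr system B' ≤ B with C^Δ(A;B'₁) ≤ exp(C·(δ⁻¹·d·log(2·κ⁻¹·d) + p·δ⁻³·log³(2p·κ⁻¹·δ⁻¹)))·C^Δ(A;B₁) and dim B' ≤ d + C·p·δ⁻²·log²(2·δ⁻¹), a B'-approximately invariant probability measure μ, and a probability measure ν supported on B'_κ, such that for every x ∈ G one has ‖f − f∗μ‖_{L_p(τ_x(ν))} ≤ δ·‖f‖_{A(G)}. -/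

import Mathlib

open scoped BigOperators Pointwise ENNReal ENat
open Real

namespace Paper

noncomputable section

/-- For `z` on the unit circle, `circNorm z = min {|θ| : z = exp(2πiθ)}`. -/
def circNorm (z : ℂ) : ℝ := |z.arg| / (2 * Real.pi)

variable {G : Type} [AddCommGroup G]

/-- The (generalised) Bohr set with frequency set `Γ` and width function `δ`. -/
def bohrSet (Γ : Set (AddChar G ℂ)) (δ : AddChar G ℂ → ℝ) : Set G :=
  {x | ∀ γ ∈ Γ, circNorm (γ x) < δ γ}

/-- `(Γ, δ)` generates the family of sets `F` as a Bohr system. -/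
def IsBohrGen (Γ : Set (AddChar G ℂ)) (δ : AddChar G ℂ → ℝ) (F : ℝ → Set G) : Prop :=
  (∀ γ ∈ Γ, 0 < δ γ) ∧ ∀ η : ℝ, 0 < η → η ≤ 1 → F η = bohrSet Γ (fun γ => η * δ γ)

/-- A Bohr system: a family `(B_η)_{η ∈ (0,1]}` of subsets of `G` of the form
`B_η = Bohr(Γ, ηδ)` for some generating pair `(Γ, δ)`. -/
structure BohrSystem (G : Type) [AddCommGroup G] where
  sets : ℝ → Set G
  exists_gen : ∃ Γ δ, IsBohrGen Γ δ sets

/-- The covering number `C(S;T) = min {|X| : S ⊆ X + T}`, valued in `ℕ∞`. -/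
def coveringNumber {H : Type} [AddCommGroup H] (S T : Set H) : ℕ∞ :=
  sInf {n : ℕ∞ | ∃ X : Finset H, (X.card : ℕ∞) = n ∧ S ⊆ (X : Set H) + T}

/-- Auxiliary quantity for the difference covering number, for a fixed target group `H`. -/
def dCovAux (S T : Set G) (H : Type) [AddCommGroup H] : ℕ∞ :=
  ⨅ (φ : G →+ H) (U : Set H) (V : Set H) (_ : S ⊆ φ ⁻¹' U) (_ : φ ⁻¹' (V - V) ⊆ T),
    coveringNumber U V

/-- The difference covering number `C^Δ(S;T)`: the infimum of `C_H(U;V)` over all abelian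
groups `H`, homomorphisms `φ : G → H` and sets `U, V ⊆ H` with `S ⊆ φ⁻¹(U)` and
`φ⁻¹(V − V) ⊆ T`. -/
def dCoveringNumber (S T : Set G) : ℕ∞ :=
  ⨅ (H : Type) (inst : AddCommGroup H), @dCovAux G _ S T H inst

/-- Interpret an extended natural number as a real number. -/
def enatReal (n : ℕ∞) : ℝ := (n.toNat : ℝ)

/-- The dimension of a family of sets: `sup {log₂ C^Δ(F_η; F_{η/2}) : η ∈ (0,1]}`. -/
def dimOfSets (F : ℝ → Set G) : ℝ :=
  sSup {r : ℝ | ∃ η : ℝ, 0 < η ∧ η ≤ 1 ∧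
    r = Real.logb 2 (enatReal (dCoveringNumber (F η) (F (η / 2))))}

/-- The dimension `dim B` of a Bohr system. -/
def BohrSystem.dim (B : BohrSystem G) : ℝ := dimOfSets B.sets

/-- The doubling dimension of a family of sets:
`sup {log₂ C(F_η; F_{η/2}) : η ∈ (0,1]}`. -/
def dimStarOfSets (F : ℝ → Set G) : ℝ :=
  sSup {r : ℝ | ∃ η : ℝ, 0 < η ∧ η ≤ 1 ∧
    r = Real.logb 2 (enatReal (coveringNumber (F η) (F (η / 2))))}

/-- The doubling dimension `dim* B` of a Bohr system. -/
def BohrSystem.dimStar (B : BohrSystem G) : ℝ := dimStarOfSets B.sets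

/-- `B' ≤ B` for Bohr systems, i.e. `B' ∧ B = B'`, i.e. `B'_η ⊆ B_η` for all `η ∈ (0,1]`. -/
def BohrSystem.le (B' B : BohrSystem G) : Prop :=
  ∀ η : ℝ, 0 < η → η ≤ 1 → B'.sets η ⊆ B.sets η

/-- The width of a Bohr system: `inf {‖δ‖_{ℓ∞(Γ)} : (Γ,δ) generates B}`. -/
def BohrSystem.width (B : BohrSystem G) : ℝ :=
  sInf {r : ℝ | ∃ Γ δ, IsBohrGen Γ δ B.sets ∧ r = sSup (δ '' Γ)}

/-- The `n`-fold sumset `nS = S + ⋯ + S`. -/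
def iterSum : ℕ → Set G → Set G
  | 0, _ => {0}
  | n + 1, S => S + iterSum n S

/-- The set of all cosets of subgroups of `G`. -/
def cosets (G : Type) [AddCommGroup G] : Set (Set G) :=
  {W | ∃ (H : AddSubgroup G) (x : G), W = (fun h => x + h) '' (H : Set G)}

/-- The set of cosets of a fixed subgroup `H` of `G`. -/
def cosetsOf (H : AddSubgroup G) : Set (Set G) :=
  {W | ∃ x : G, W = (fun h => x + h) '' (H : Set G)}

/-- `f` is `ε`-almost integer-valued, with integer part `fZ`. -/
def AlmostInt (ε : ℝ) (f : G → ℂ) (fZ : G → ℤ) : Prop :=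
  ∀ x, ‖f x - (fZ x : ℂ)‖ ≤ ε

/-- The `ρ`-approximate annihilator `N(S,ρ)` of a set `S ⊆ G`. -/
def annihilator (S : Set G) (ρ : ℝ) : Set (AddChar G ℂ) :=
  {γ | ∀ x ∈ S, ‖(1 : ℂ) - γ x‖ < ρ}

/-- `A` is `(m,l)`-arithmetically connected. -/
def ArithConnected (m l : ℕ) (A : Set G) : Prop :=
  ∀ x : Fin m → G, (∀ i, x i ∈ A) →
    ∃ σ : Fin m → ℤ, (∑ i, (σ i).natAbs) ≤ l ∧
      (∃ i j, i ≠ j ∧ (σ i).natAbs = 1 ∧ (σ j).natAbs = 1) ∧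
      (∑ i, σ i • x i) ∈ A

variable [Fintype G]

/-- The Haar probability measure of a subset of the finite group `G`. -/
def haar (S : Set G) : ℝ := (Nat.card S : ℝ) / (Fintype.card G : ℝ)

/-- A probability measure on the finite group `G`, given by its weight function. -/
def IsProb (w : G → ℝ) : Prop := (∀ x, 0 ≤ w x) ∧ ∑ x, w x = 1

/-- The measure of `S` under the weight function `w`. -/
def wMeasure (w : G → ℝ) (S : Set G) : ℝ := ∑ x, S.indicator w x

/-- The probability measure `μ_S`: `μ` restricted to `S` and normalised. -/
def restrictProb (w : G → ℝ) (S : Set G) : G → ℝ :=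
  fun x => S.indicator w x / wMeasure w S

/-- The probability measure `w` is `F`-approximately invariant: for every `η ∈ (0,1]` there
are probability measures `w⁺, w⁻` with `(1−η)·w⁻ ≤ τ_x(w) ≤ (1+η)·w⁺` for all `x ∈ F η`. -/
def ApproxInvariant (F : ℝ → Set G) (w : G → ℝ) : Prop :=
  ∀ η : ℝ, 0 < η → η ≤ 1 → ∃ wp wm : G → ℝ, IsProb wp ∧ IsProb wm ∧
    ∀ x ∈ F η, ∀ y : G, (1 - η) * wm y ≤ w (y - x) ∧ w (y - x) ≤ (1 + η) * wp y

/-- The Fourier coefficient `f̂(γ) = (1/|G|) ∑_x f(x) conj(γ(x))`. -/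
def fourierCoeff (f : G → ℂ) (γ : AddChar G ℂ) : ℂ :=
  (Fintype.card G : ℂ)⁻¹ * ∑ x, f x * (starRingEnd ℂ) (γ x)

/-- The Wiener norm `‖f‖_{A(G)} = ∑_γ |f̂(γ)|`. -/
def wienerNorm (f : G → ℂ) : ℝ := ∑ᶠ γ : AddChar G ℂ, ‖fourierCoeff f γ‖

/-- The Fourier transform `μ̂(γ) = ∫ conj(γ(x)) dμ(x)` of a measure with weight `w`. -/
def fourierWeight (w : G → ℝ) (γ : AddChar G ℂ) : ℂ :=
  ∑ x, (starRingEnd ℂ) (γ x) * (w x : ℂ)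

/-- Convolution `f ∗ μ (x) = ∫ f(x−y) dμ(y)` of a complex function with a measure. -/
def convC (f : G → ℂ) (w : G → ℝ) (x : G) : ℂ := ∑ y, f (x - y) * (w y : ℂ)

/-- Convolution `f ∗ μ (x) = ∫ f(x−y) dμ(y)` of a real function with a measure. -/
def convR (f : G → ℝ) (w : G → ℝ) (x : G) : ℝ := ∑ y, f (x - y) * w y

/-- Convolution of functions w.r.t. Haar measure: `f ∗ g (x) = (1/|G|) ∑_y f(y) g(x−y)`. -/
def convFun (f g : G → ℝ) (x : G) : ℝ := (Fintype.card G : ℝ)⁻¹ * ∑ y, f y * g (x - y)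

/-- The `L_p` norm `(∫ |f|^p dν)^{1/p}` w.r.t. the measure with weight `w`. -/
def LpW (p : ℝ) (w : G → ℝ) (f : G → ℂ) : ℝ := (∑ y, w y * ‖f y‖ ^ p) ^ (1 / p)

/-- `X` has relative polynomial growth of order `d`. -/
def HasRPG (X : Set G) (d : ℝ) : Prop :=
  ∀ n : ℕ, 1 ≤ n → haar (iterSum n X) ≤ (n : ℝ) ^ d * haar X

end

open Real

/-- Finite difference coverings. -/
def IsCov {G : Type} [AddCommGroup G] (S T : Set G) (n : ℕ) : Prop :=
  ∃ (H : Type) (_ : AddCommGroup H) (φ : G →+ H) (X : Finset H) (V : Set H),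
    X.card ≤ n ∧ (∀ s ∈ S, φ s ∈ (X : Set H) + V) ∧ ∀ g, φ g ∈ V - V → g ∈ T

section cov
variable {G : Type} [AddCommGroup G]

lemma IsCov.dCov_le {S T : Set G} {n : ℕ} (h : IsCov S T n) :
    dCoveringNumber S T ≤ n := by
  obtain ⟨H, inst, φ, X, V, hX, hS, hT⟩ := h
  unfold dCoveringNumber
  refine (iInf₂_le H inst).trans ?_
  unfold dCovAux
  refine (iInf₂_le φ ((X : Set H) + V)).trans ?_
  refine (iInf_le _ V).trans ((iInf₂_le (fun s hs => hS s hs) (fun g hg => hT g hg)).trans ?_)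
  unfold coveringNumber
  have h1 : ((X.card : ℕ) : ℕ∞) ∈ {n : ℕ∞ | ∃ X' : Finset H, (X'.card : ℕ∞) = n ∧
      (X : Set H) + V ⊆ (X' : Set H) + V} := ⟨X, rfl, le_rfl⟩
  refine (sInf_le h1).trans ?_
  exact_mod_cast hX

lemma isCov_of_dCov_le {S T : Set G} {n : ℕ} (h : dCoveringNumber S T ≤ n) :
    IsCov S T n := by
  have h1 : dCoveringNumber S T < ((n + 1 : ℕ) : ℕ∞) :=
    lt_of_le_of_lt h (by exact_mod_cast Nat.lt_succ_self n)
  unfold dCoveringNumber at h1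
  simp only [dCovAux, iInf_lt_iff] at h1
  obtain ⟨H, inst, φ, U, V, hU, hV, hlt⟩ := h1
  unfold coveringNumber at hlt
  rw [sInf_lt_iff] at hlt
  obtain ⟨_, ⟨X, rfl, hX⟩, hlt⟩ := hlt
  refine ⟨H, inst, φ, X, V, ?_, fun s hs => hX (hU hs), fun g hg => hV hg⟩
  have : X.card < n + 1 := by exact_mod_cast hlt
  omega

lemma IsCov.mono {S S' T T' : Set G} {n n' : ℕ} (h : IsCov S T n) (hS : S' ⊆ S) (hT : T ⊆ T')
    (hn : n ≤ n') : IsCov S' T' n' := by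
  obtain ⟨H, inst, φ, X, V, h1, h2, h3⟩ := h
  exact ⟨H, inst, φ, X, V, h1.trans hn, fun s hs => h2 s (hS hs), fun g hg => hT (h3 g hg)⟩

/-- From a difference covering we get a covering by translates. -/
lemma IsCov.cover {S T : Set G} {n : ℕ} (h : IsCov S T n) :
    ∃ Y : Finset G, Y.card ≤ n ∧ ∀ s ∈ S, ∃ y ∈ Y, s - y ∈ T := by
  classical
  obtain ⟨H, inst, φ, X, V, h1, h2, h3⟩ := h
  let good : H → Prop := fun x => ∃ s ∈ S, φ s - x ∈ V
  let c : H → G := fun x => if hx : good x then hx.choose else 0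
  refine ⟨X.image c, Finset.card_image_le.trans h1, ?_⟩
  intro s hs
  obtain ⟨x, hx, v, hv, hxv⟩ := Set.mem_add.1 (h2 s hs)
  have hg : good x := ⟨s, hs, by rw [← hxv]; simpa using hv⟩
  refine ⟨c x, Finset.mem_image_of_mem _ hx, h3 _ ?_⟩
  have hc : φ (c x) - x ∈ V := by
    have := hg.choose_spec.2
    simp only [c, dif_pos hg]; exact this
  refine Set.mem_sub.2 ⟨v, hv, _, hc, ?_⟩
  rw [map_sub, ← hxv]; abel

lemma IsCov.trans {S T R : Set G} {n m : ℕ} (h : IsCov S T n) (h' : IsCov T R m) :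
    IsCov S R (n * m) := by
  classical
  obtain ⟨Y, hY, hS⟩ := h.cover
  obtain ⟨H, inst, φ, X, V, h1, h2, h3⟩ := h'
  refine ⟨H, inst, φ, Y.image φ + X, V, ?_, ?_, h3⟩
  · exact (Finset.card_add_le).trans (Nat.mul_le_mul (Finset.card_image_le.trans hY) h1)
  · intro s hs
    obtain ⟨y, hy, hsy⟩ := hS s hs
    obtain ⟨x, hx, v, hv, hxv⟩ := Set.mem_add.1 (h2 _ hsy)
    refine Set.mem_add.2 ⟨φ y + x, ?_, v, hv, ?_⟩
    · exact Finset.mem_coe.2 (Finset.add_mem_add (Finset.mem_image_of_mem _ hy) hx)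
    · rw [add_assoc, hxv, map_sub]; abel

lemma IsCov.inter {S T S' T' : Set G} {n m : ℕ} (h : IsCov S T n) (h' : IsCov S' T' m) :
    IsCov (S ∩ S') (T ∩ T') (n * m) := by
  classical
  obtain ⟨H, inst, φ, X, V, h1, h2, h3⟩ := h
  obtain ⟨H', inst', φ', X', V', h1', h2', h3'⟩ := h'
  refine ⟨H × H', inferInstance, φ.prod φ', X ×ˢ X', V ×ˢ V', ?_, ?_, ?_⟩
  · rw [Finset.card_product]; exact Nat.mul_le_mul h1 h1'
  · intro s hs
    obtain ⟨x, hx, v, hv, hxv⟩ := Set.mem_add.1 (h2 _ hs.1)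
    obtain ⟨x', hx', v', hv', hxv'⟩ := Set.mem_add.1 (h2' _ hs.2)
    refine Set.mem_add.2 ⟨(x, x'), ?_, (v, v'), ⟨hv, hv'⟩, ?_⟩
    · simp only [Finset.coe_product]; exact ⟨hx, hx'⟩
    · simp [hxv, hxv']
  · intro g hg
    obtain ⟨a, ha, b, hb, hab⟩ := Set.mem_sub.1 hg
    refine ⟨h3 g (Set.mem_sub.2 ⟨a.1, ha.1, b.1, hb.1, ?_⟩),
      h3' g (Set.mem_sub.2 ⟨a.2, ha.2, b.2, hb.2, ?_⟩)⟩
    · exact congrArg Prod.fst hab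
    · exact congrArg Prod.snd hab

lemma isCov_finite [Fintype G] {S T : Set G} (h0 : (0 : G) ∈ T) : IsCov S T (Fintype.card G) := by
  refine ⟨G, inferInstance, AddMonoidHom.id G, Finset.univ, {0}, le_rfl, ?_, ?_⟩
  · intro s _
    exact Set.mem_add.2 ⟨s, by simp, 0, rfl, by simp⟩
  · intro g hg
    simp at hg
    rw [hg]; exact h0

end cov

/-! ### circle facts -/

lemma circNorm_nonneg (z : ℂ) : 0 ≤ circNorm z := by unfold circNorm; positivity

lemma circNorm_one : circNorm 1 = 0 := by simp [circNorm]

lemma circNorm_le (z : ℂ) : circNorm z ≤ 1 / 2 := by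
  unfold circNorm
  rw [div_le_iff₀ (by positivity)]
  linarith [Complex.abs_arg_le_pi z]

lemma circNorm_eq (z : ℂ) : circNorm z = ‖((z.arg : ℝ) : AddCircle (2 * π))‖ / (2 * π) := by
  unfold circNorm
  congr 1
  symm
  rw [AddCircle.norm_coe_eq_abs_iff _ (by positivity)]
  rw [abs_of_pos (show (0 : ℝ) < 2 * π by positivity)]
  linarith [Complex.abs_arg_le_pi z]

lemma arg_mul_circle {z w : ℂ} (hz : z ≠ 0) (hw : w ≠ 0) :
    (((z * w).arg : ℝ) : AddCircle (2 * π)) = (z.arg : AddCircle (2 * π)) + (w.arg : AddCircle (2 * π)) :=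
  Complex.arg_mul_coe_angle hz hw

lemma norm_one_sub_le {z : ℂ} (hz : ‖z‖ = 1) : ‖1 - z‖ ≤ 2 * π * circNorm z := by
  have h1 : z = Complex.exp (Complex.I * z.arg) := by
    have := Complex.norm_mul_exp_arg_mul_I z
    rw [hz] at this
    rw [mul_comm]; simpa using this.symm
  have h2 : ‖Complex.exp (Complex.I * z.arg) - 1‖ ≤ ‖z.arg‖ :=
    Real.norm_exp_I_mul_ofReal_sub_one_le
  rw [← h1] at h2
  rw [norm_sub_rev]
  refine h2.trans (le_of_eq ?_)
  unfold circNorm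
  rw [Real.norm_eq_abs]; field_simp

section char
variable {G : Type} [AddCommGroup G]

lemma char_ne (γ : AddChar G ℂ) (x : G) : γ x ≠ 0 := by
  intro h
  have := γ.map_add_eq_mul x (-x)
  rw [h] at this; simp at this

/-- The homomorphism to the circle given by a character. -/
noncomputable def angHom (γ : AddChar G ℂ) : G →+ AddCircle (2 * π) where
  toFun x := (((γ x).arg : ℝ) : AddCircle (2 * π))
  map_zero' := by simp
  map_add' x y := by rw [γ.map_add_eq_mul, arg_mul_circle (char_ne γ x) (char_ne γ y)]

lemma circNorm_char (γ : AddChar G ℂ) (x : G) : circNorm (γ x) = ‖angHom γ x‖ / (2 * π) :=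
  circNorm_eq _

lemma circNorm_char_add (γ : AddChar G ℂ) (x y : G) :
    circNorm (γ (x + y)) ≤ circNorm (γ x) + circNorm (γ y) := by
  simp only [circNorm_char, map_add, ← add_div]
  gcongr
  exact norm_add_le _ _

lemma circNorm_char_neg (γ : AddChar G ℂ) (x : G) :
    circNorm (γ (-x)) = circNorm (γ x) := by
  simp only [circNorm_char, map_neg, norm_neg]

lemma isCov_char (γ : AddChar G ℂ) {r s : ℝ} (hs : 0 < s) (N : ℕ) (hN : 2 * r ≤ N * s) :
    IsCov {x | circNorm (γ x) < r} {x | circNorm (γ x) < s} N := by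
  classical
  have hpi := Real.pi_pos
  refine ⟨AddCircle (2 * π), inferInstance, angHom γ,
    (Finset.range N).image (fun j : ℕ => ((2 * π * (-r + s * j) : ℝ) : AddCircle (2 * π))),
    (fun t : ℝ => (t : AddCircle (2 * π))) '' Set.Ico 0 (2 * π * s), ?_, ?_, ?_⟩
  · exact Finset.card_image_le.trans (by simp)
  · intro x hx
    have hx' : |(γ x).arg| < 2 * π * r := by
      have : circNorm (γ x) < r := hx
      unfold circNorm at this
      rw [div_lt_iff₀ (by positivity)] at this; linarith
    obtain ⟨hl, hu⟩ := abs_lt.1 hx'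
    set a := (γ x).arg with ha
    set u := (a / (2 * π) + r) / s with hu'
    have hau : a = 2 * π * (-r + s * u) := by rw [hu']; field_simp; ring
    have hu0 : 0 ≤ u := by
      have : 0 < a / (2 * π) + r := by
        have : -r < a / (2 * π) := by rw [lt_div_iff₀ (by positivity)]; linarith
        linarith
      positivity
    have huN : u < N := by
      rw [hu', div_lt_iff₀ hs]
      have : a / (2 * π) < r := by rw [div_lt_iff₀ (by positivity)]; linarith
      linarith
    refine Set.mem_add.2 ⟨((2 * π * (-r + s * (⌊u⌋₊ : ℕ)) : ℝ) : AddCircle (2 * π)), ?_,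
      ((2 * π * s * (u - ⌊u⌋₊) : ℝ) : AddCircle (2 * π)), ⟨_, ⟨?_, ?_⟩, rfl⟩, ?_⟩
    · rw [Finset.mem_coe, Finset.mem_image]
      exact ⟨⌊u⌋₊, Finset.mem_range.2 ((Nat.floor_lt hu0).2 huN), rfl⟩
    · have := Nat.floor_le hu0
      have : 0 ≤ u - ⌊u⌋₊ := by linarith
      positivity
    · have := Nat.lt_floor_add_one u
      have : u - ⌊u⌋₊ < 1 := by linarith
      calc 2 * π * s * (u - ⌊u⌋₊) < 2 * π * s * 1 := by
            apply mul_lt_mul_of_pos_left this (by positivity)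
        _ = _ := by ring
    · change _ = ((a : ℝ) : AddCircle (2 * π))
      rw [← AddCircle.coe_add, hau]
      congr 1; ring
  · intro g hg
    obtain ⟨_, ⟨a, ha, rfl⟩, _, ⟨b, hb, rfl⟩, hab⟩ := Set.mem_sub.1 hg
    change circNorm (γ g) < s
    rw [circNorm_char, ← hab, ← AddCircle.coe_sub, div_lt_iff₀ (by positivity)]
    have h1 : ‖((a - b : ℝ) : AddCircle (2 * π))‖ ≤ |a - b| := by
      exact QuotientAddGroup.norm_mk_le_norm
    refine lt_of_le_of_lt h1 ?_
    rw [abs_lt]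
    have := ha.1; have := ha.2; have := hb.1; have := hb.2
    constructor <;> linarith

lemma char_norm [Finite G] (γ : AddChar G ℂ) (x : G) : ‖γ x‖ = 1 := AddChar.norm_apply γ x

end char

/-- Norm-like functions generating Bohr systems. -/
structure IsBN {G : Type} [AddCommGroup G] (ρ : G → ℝ) : Prop where
  nonneg : ∀ x, 0 ≤ ρ x
  zero : ρ 0 = 0
  neg : ∀ x, ρ (-x) = ρ x
  add : ∀ x y, ρ (x + y) ≤ ρ x + ρ y
  gen : ∃ (Γ : Set (AddChar G ℂ)) (δ : AddChar G ℂ → ℝ), (∀ γ ∈ Γ, 0 < δ γ) ∧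
    ∀ η : ℝ, 0 < η → ∀ x, ρ x < η ↔ x ∈ bohrSet Γ (fun γ => η * δ γ)

/-- The dimension of the system generated by `ρ` is at most `D`. -/
def DimLE {G : Type} [AddCommGroup G] (ρ : G → ℝ) (D : ℝ) : Prop :=
  ∀ η : ℝ, 0 < η → η ≤ 1 → ∃ n : ℕ, (n : ℝ) ≤ (2 : ℝ) ^ D ∧
    IsCov {x | ρ x < η} {x | ρ x < η / 2} n

section bn
variable {G : Type} [AddCommGroup G]

lemma exists_BN [Fintype G] (B : BohrSystem G) :
    ∃ ρ : G → ℝ, IsBN ρ ∧ ∀ η : ℝ, 0 < η → η ≤ 1 → B.sets η = {x | ρ x < η} := by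
  classical
  obtain ⟨Γ, δ, hδ, hB⟩ := B.exists_gen
  let t : G → AddChar G ℂ → ℝ := fun x γ => if γ ∈ Γ then circNorm (γ x) / δ γ else 0
  have hne : (Finset.univ : Finset (AddChar G ℂ)).Nonempty := ⟨0, Finset.mem_univ _⟩
  have t0 : ∀ x γ, 0 ≤ t x γ := by
    intro x γ
    simp only [t]
    split_ifs with h
    · exact div_nonneg (circNorm_nonneg _) (hδ γ h).le
    · exact le_rfl
  let ρ : G → ℝ := fun x => Finset.univ.sup' hne (t x)
  have hρ : ∀ η : ℝ, 0 < η → ∀ x, ρ x < η ↔ x ∈ bohrSet Γ (fun γ => η * δ γ) := by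
    intro η hη x
    simp only [ρ, Finset.sup'_lt_iff, Finset.mem_univ, true_implies, bohrSet, Set.mem_ofPred_eq]
    refine forall_congr' fun γ => ?_
    by_cases h : γ ∈ Γ
    · simp only [t, if_pos h, h, true_implies]
      rw [div_lt_iff₀ (hδ γ h)]
    · simp [t, h, hη]
  refine ⟨ρ, ⟨?_, ?_, ?_, ?_, Γ, δ, hδ, hρ⟩, ?_⟩
  · intro x
    exact (t0 x 0).trans (Finset.le_sup' (t x) (Finset.mem_univ _))
  · have : t 0 = fun _ => 0 := by
      funext γ
      simp [t, circNorm_one]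
    simp [ρ, this]
  · intro x
    have : t (-x) = t x := by
      funext γ
      simp only [t, circNorm_char_neg]
    simp only [ρ, this]
  · intro x y
    refine Finset.sup'_le _ _ fun γ hγ => ?_
    refine le_trans ?_ (add_le_add (Finset.le_sup' (t x) hγ) (Finset.le_sup' (t y) hγ))
    simp only [t]
    split_ifs with h
    · rw [← add_div]
      have := hδ γ h
      gcongr
      exact circNorm_char_add γ x y
    · simp
  · intro η h0 h1
    rw [hB η h0 h1]
    ext x
    exact (hρ η h0 x).symm

/-- The Bohr system generated by a norm-like function. -/
def IsBN.system {ρ : G → ℝ} (h : IsBN ρ) : BohrSystem G where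
  sets := fun η => {x | ρ x < η}
  exists_gen := by
    obtain ⟨Γ, δ, hδ, hρ⟩ := h.gen
    exact ⟨Γ, δ, hδ, fun η h0 _ => Set.ext fun x => hρ η h0 x⟩

lemma IsBN.scale {ρ : G → ℝ} (h : IsBN ρ) {l : ℝ} (hl : 0 < l) : IsBN (fun x => ρ x / l) := by
  obtain ⟨Γ, δ, hδ, hρ⟩ := h.gen
  refine ⟨fun x => div_nonneg (h.nonneg x) hl.le, by simp [h.zero], fun x => by simp [h.neg], ?_,
    Γ, fun γ => l * δ γ, fun γ hγ => mul_pos hl (hδ γ hγ), ?_⟩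
  · intro x y
    rw [← add_div]
    gcongr
    exact h.add x y
  · intro η hη x
    rw [div_lt_iff₀ hl, hρ (η * l) (by positivity) x]
    simp only [mul_assoc]

lemma IsBN.adjoin {ρ : G → ℝ} (h : IsBN ρ) (γ : AddChar G ℂ) {w : ℝ} (hw : 0 < w) :
    IsBN (fun x => max (ρ x) (circNorm (γ x) / w)) := by
  classical
  obtain ⟨Γ, δ, hδ, hρ⟩ := h.gen
  refine ⟨fun x => (h.nonneg x).trans (le_max_left _ _), ?_, ?_, ?_, insert γ Γ,
    fun γ' => if γ' = γ then (if γ ∈ Γ then min (δ γ) w else w) else δ γ', ?_, ?_⟩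
  · simp [h.zero, circNorm_one]
  · intro x
    simp only [h.neg, circNorm_char_neg]
  · intro x y
    refine max_le ((h.add x y).trans (add_le_add (le_max_left _ _) (le_max_left _ _))) ?_
    refine le_trans ?_ (add_le_add (le_max_right _ _) (le_max_right _ _))
    rw [← add_div]
    gcongr
    exact circNorm_char_add γ x y
  · intro γ' hγ'
    simp only
    split_ifs with h1 h2
    · exact lt_min (hδ _ h2) hw
    · exact hw
    · exact hδ _ (by simpa [h1] using hγ')
  · intro η hη x
    rw [max_lt_iff, hρ η hη x, div_lt_iff₀ hw]
    simp only [bohrSet, Set.mem_ofPred_eq]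
    constructor
    · rintro ⟨h1, h2⟩ γ' hγ'
      by_cases hh : γ' = γ
      · subst hh
        simp only [if_true]
        split_ifs with h3
        · rw [mul_min_of_nonneg _ _ hη.le]
          exact lt_min (h1 _ h3) h2
        · exact h2
      · simp only [if_neg hh]
        exact h1 γ' (by simpa [hh] using hγ')
    · intro h1
      constructor
      · intro γ' hγ'
        have := h1 γ' (Set.mem_insert_of_mem _ hγ')
        by_cases hh : γ' = γ
        · subst hh
          simp only [if_true, if_pos hγ'] at this
          refine this.trans_le ?_
          gcongr
          exact min_le_left _ _
        · simpa only [if_neg hh] using this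
      · have := h1 γ (Set.mem_insert _ _)
        simp only [if_true] at this
        refine this.trans_le ?_
        gcongr
        split_ifs
        · exact min_le_right _ _
        · exact le_rfl

lemma adjoin_family {ρ : G → ℝ} (h : IsBN ρ) {w : ℝ} (hw : 0 < w) (N : ℕ) (hN : 2 ≤ N * w)
    (A : Set G) (Λ : Finset (AddChar G ℂ)) :
    ∃ ρ' : G → ℝ, IsBN ρ' ∧ (∀ x, ρ x ≤ ρ' x) ∧
      (∀ x, ρ' x < 1 → ∀ γ ∈ Λ, circNorm (γ x) < w) ∧
      (∀ η : ℝ, 0 < η → ∀ n, IsCov {x | ρ x < η} {x | ρ x < η / 2} n →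
        IsCov {x | ρ' x < η} {x | ρ' x < η / 2} (n * 4 ^ Λ.card)) ∧
      (∀ n, IsCov A {x | ρ x < 1} n → IsCov A {x | ρ' x < 1} (n * N ^ Λ.card)) := by
  classical
  induction Λ using Finset.induction_on with
  | empty => exact ⟨ρ, h, fun _ => le_rfl, by simp, by simp, by simp⟩
  | insert γ Λ hγ ih =>
    obtain ⟨ρ', h', hle, hΛ, hdim, hcov⟩ := ih
    have key : ∀ η : ℝ, {x | max (ρ' x) (circNorm (γ x) / w) < η} =
        {x | ρ' x < η} ∩ {x | circNorm (γ x) < η * w} := by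
      intro η
      ext x
      simp [div_lt_iff₀ hw]
    refine ⟨_, h'.adjoin γ hw, fun x => (hle x).trans (le_max_left _ _), ?_, ?_, ?_⟩
    · intro x hx γ' hγ'
      have hx' : x ∈ {x | ρ' x < 1} ∩ {x | circNorm (γ x) < 1 * w} := by
        rw [← key]; exact hx
      rcases Finset.mem_insert.1 hγ' with rfl | h2
      · simpa using hx'.2
      · exact hΛ x hx'.1 γ' h2
    · intro η hη n hn
      rw [key, key, Finset.card_insert_of_notMem hγ, pow_succ, ← mul_assoc]
      refine (hdim η hη n hn).inter (isCov_char γ (by positivity) 4 ?_)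
      push_cast; linarith
    · intro n hn
      rw [key, Finset.card_insert_of_notMem hγ, pow_succ, ← mul_assoc]
      refine ((hcov n hn).inter (isCov_char γ (r := 1) (by positivity) N ?_)).mono ?_ le_rfl le_rfl
      · linarith
      · intro x hx
        refine ⟨hx, ?_⟩
        have := circNorm_le (γ x)
        simp only [Set.mem_ofPred_eq]; linarith

lemma DimLE.scale {ρ : G → ℝ} {D : ℝ} (h : DimLE ρ D) {l : ℝ} (hl : 0 < l) (hl1 : l ≤ 1) :
    DimLE (fun x => ρ x / l) D := by
  intro η h0 h1
  obtain ⟨n, hn, hc⟩ := h (η * l) (by positivity) (by nlinarith)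
  refine ⟨n, hn, ?_⟩
  have e1 : {x | ρ x / l < η} = {x | ρ x < η * l} := by ext x; simp [div_lt_iff₀ hl]
  have e2 : {x | ρ x / l < η / 2} = {x | ρ x < η * l / 2} := by
    ext x; simp only [div_lt_iff₀ hl, Set.mem_ofPred_eq]; ring_nf
  rw [e1, e2]; exact hc

lemma DimLE.iter {ρ : G → ℝ} {D : ℝ} (h : DimLE ρ D) (q : ℕ) :
    ∃ n : ℕ, (n : ℝ) ≤ ((2 : ℝ) ^ D) ^ (q + 1) ∧
      IsCov {x | ρ x < 1} {x | ρ x < (1 / 2) ^ (q + 1)} n := by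
  induction q with
  | zero =>
    obtain ⟨n, hn, hc⟩ := h 1 one_pos le_rfl
    exact ⟨n, by simpa using hn, by simpa using hc⟩
  | succ q ih =>
    obtain ⟨n, hn, hc⟩ := ih
    obtain ⟨n', hn', hc'⟩ := h ((1 / 2) ^ (q + 1)) (by positivity)
      (pow_le_one₀ (by norm_num) (by norm_num))
    refine ⟨n * n', ?_, ?_⟩
    · push_cast
      rw [pow_succ _ (q + 1)]
      gcongr
    · have := hc.trans hc'
      rwa [show ((1 : ℝ) / 2) ^ (q + 1) / 2 = (1 / 2) ^ (q + 1 + 1) by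
        rw [pow_succ _ (q + 1)]; ring] at this

lemma DimLE.card_le [Fintype G] {ρ : G → ℝ} {D : ℝ} (h : DimLE ρ D) {η : ℝ} (h0 : 0 < η)
    (h1 : η ≤ 1) [DecidablePred fun x => ρ x < η] [DecidablePred fun x => ρ x < η / 2] :
    ((Finset.univ.filter fun x => ρ x < η).card : ℝ) ≤
      2 ^ D * (Finset.univ.filter fun x => ρ x < η / 2).card := by
  classical
  obtain ⟨n, hn, hc⟩ := h η h0 h1
  obtain ⟨Y, hY, hS⟩ := hc.cover
  have hsub : (Finset.univ.filter fun x => ρ x < η) ⊆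
      Y + (Finset.univ.filter fun x => ρ x < η / 2) := by
    intro x hx
    obtain ⟨y, hy, hxy⟩ := hS x (by simpa using hx)
    refine Finset.mem_add.2 ⟨y, hy, x - y, by simpa using hxy, by abel⟩
  have := (Finset.card_le_card hsub).trans Finset.card_add_le
  calc ((Finset.univ.filter fun x => ρ x < η).card : ℝ) ≤
      (Y.card : ℝ) * (Finset.univ.filter fun x => ρ x < η / 2).card := by exact_mod_cast this
    _ ≤ _ := by
      gcongr
      exact le_trans (by exact_mod_cast hY) hn

end bn

section dims
set_option linter.unusedSectionVars false
variable {G : Type} [AddCommGroup G] [Fintype G]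

lemma dimLE_of_system (B : BohrSystem G) {ρ : G → ℝ} (hρ : IsBN ρ)
    (hB : ∀ η : ℝ, 0 < η → η ≤ 1 → B.sets η = {x | ρ x < η}) {d : ℝ} (hd : B.dim ≤ d) :
    DimLE ρ d := by
  intro η h0 h1
  have h02 : (0 : G) ∈ B.sets (η / 2) := by
    rw [hB _ (by positivity) (by linarith)]
    simp [hρ.zero, h0]
  have hbd : ∀ η : ℝ, 0 < η → η ≤ 1 →
      (dCoveringNumber (B.sets η) (B.sets (η / 2))) ≤ (Fintype.card G : ℕ∞) := by
    intro η h0 h1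
    refine (isCov_finite ?_).dCov_le
    rw [hB _ (by positivity) (by linarith)]
    simp [hρ.zero, h0]
  have htop := ne_top_of_le_ne_top (ENat.natCast_ne_top _) (hbd η h0 h1)
  refine ⟨(dCoveringNumber (B.sets η) (B.sets (η / 2))).toNat, ?_, ?_⟩
  · have hb : BddAbove {r : ℝ | ∃ η : ℝ, 0 < η ∧ η ≤ 1 ∧
        r = Real.logb 2 (enatReal (dCoveringNumber (B.sets η) (B.sets (η / 2))))} := by
      refine ⟨Real.logb 2 (Fintype.card G), ?_⟩
      rintro r ⟨η, h0, h1, rfl⟩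
      have h3 := ENat.toNat_le_of_le_natCast (hbd η h0 h1)
      rcases Nat.eq_zero_or_pos (dCoveringNumber (B.sets η) (B.sets (η / 2))).toNat with h4 | h4
      · simp only [enatReal, h4]
        simp only [Nat.cast_zero, Real.logb_zero]
        exact Real.logb_nonneg (by norm_num) (by exact_mod_cast Fintype.card_pos)
      · unfold enatReal
        apply Real.logb_le_logb_of_le (by norm_num) (by exact_mod_cast h4)
        exact_mod_cast h3
    have h5 : Real.logb 2 (enatReal (dCoveringNumber (B.sets η) (B.sets (η / 2)))) ≤ d :=
      (le_csSup hb ⟨η, h0, h1, rfl⟩).trans hd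
    rcases Nat.eq_zero_or_pos (dCoveringNumber (B.sets η) (B.sets (η / 2))).toNat with h4 | h4
    · rw [h4]; simp; positivity
    · rwa [enatReal, Real.logb_le_iff_le_rpow (by norm_num) (by exact_mod_cast h4)] at h5
  · have := isCov_of_dCov_le (G := G) (S := B.sets η) (T := B.sets (η / 2))
      (n := (dCoveringNumber (B.sets η) (B.sets (η / 2))).toNat) (ENat.natCast_toNat htop).ge
    refine this.mono (hB η h0 h1).ge (hB (η / 2) (by positivity) (by linarith)).le le_rfl

lemma IsBN.system_dim {ρ : G → ℝ} (h : IsBN ρ) {D : ℝ} (hD : 0 ≤ D) (hd : DimLE ρ D) :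
    h.system.dim ≤ D := by
  refine csSup_le ⟨_, 1, one_pos, le_rfl, rfl⟩ ?_
  rintro r ⟨η, h0, h1, rfl⟩
  obtain ⟨n, hn, hc⟩ := hd η h0 h1
  change Real.logb 2 (enatReal (dCoveringNumber {x | ρ x < η} {x | ρ x < η / 2})) ≤ D
  have h3 := ENat.toNat_le_of_le_natCast hc.dCov_le
  rcases Nat.eq_zero_or_pos (dCoveringNumber {x | ρ x < η} {x | ρ x < η / 2}).toNat with h4 | h4
  · simpa [enatReal, h4] using hD
  · rw [enatReal, Real.logb_le_iff_le_rpow (by norm_num) (by exact_mod_cast h4)]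
    exact le_trans (by exact_mod_cast h3) hn

end dims

section inv
set_option linter.unusedSectionVars false
variable {G : Type} [AddCommGroup G] [Fintype G]

lemma isProb_normalize {W : G → ℝ} (h0 : ∀ y, 0 ≤ W y) (hT : 0 < ∑ y, W y) :
    IsProb (fun y => W y / ∑ z, W z) := by
  refine ⟨fun y => div_nonneg (h0 y) hT.le, ?_⟩
  rw [← Finset.sum_div, div_self hT.ne']

set_option maxHeartbeats 1000000 in
lemma invMeasure {ρ : G → ℝ} (h : IsBN ρ) {D : ℝ} (hD : 1 ≤ D) (hd : DimLE ρ D) :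
    ∃ w : G → ℝ, IsProb w ∧ (∀ y, w y ≠ 0 → ρ y < 1) ∧
      ApproxInvariant (fun η => {x | ρ x < η / (80 * D)}) w := by
  classical
  set K : ℝ := 20 * D with hK
  have hKpos : 0 < K := by positivity
  set c : ℝ := Real.exp (-K / 2) with hc
  set E : G → ℝ := fun y => Real.exp (-K * ρ y) with hE
  have hEpos : ∀ y, 0 < E y := fun y => Real.exp_pos _
  set W : ℝ → G → ℝ := fun t y => max (t * E y - c) 0 with hW
  have hW0 : ∀ t y, 0 ≤ W t y := fun t y => le_max_right _ _
  set F : Finset G := Finset.univ.filter fun x => ρ x < 1 with hF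
  set Z : ℝ := ∑ y ∈ F, E y with hZ
  set T : ℝ → ℝ := fun t => ∑ y, W t y with hT
  -- support
  have hsupp : ∀ t, t ≤ Real.exp (1 / 4) → ∀ y, y ∉ F → W t y = 0 := by
    intro t ht y hy
    have hy' : 1 ≤ ρ y := by simpa [hF] using hy
    apply max_eq_right
    have h1 : E y ≤ Real.exp (-K) := Real.exp_le_exp.2 (by nlinarith)
    have h2 : t * E y ≤ Real.exp (1 / 4) * Real.exp (-K) := by
      calc t * E y ≤ Real.exp (1 / 4) * E y := by gcongr
        _ ≤ _ := by gcongr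
    rw [← Real.exp_add] at h2
    have h3 : Real.exp (1 / 4 + -K) ≤ c := Real.exp_le_exp.2 (by linarith)
    linarith
  have hTF : ∀ t, t ≤ Real.exp (1 / 4) → T t = ∑ y ∈ F, W t y := by
    intro t ht
    exact (Finset.sum_subset (Finset.subset_univ F) fun y _ hy => hsupp t ht y hy).symm
  -- mass
  have hZ1 : ((Finset.univ.filter fun x => ρ x < 1 / 2 / 2).card : ℝ) * Real.exp (-K / 4) ≤ Z := by
    have hsub : (Finset.univ.filter fun x => ρ x < 1 / 2 / 2) ⊆ F := by
      intro x hx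
      simp only [Finset.mem_filter, Finset.mem_univ, true_and, hF] at hx ⊢
      linarith
    calc _ = ∑ y ∈ (Finset.univ.filter fun x => ρ x < 1 / 2 / 2), Real.exp (-K / 4) := by
          rw [Finset.sum_const, nsmul_eq_mul]
      _ ≤ ∑ y ∈ (Finset.univ.filter fun x => ρ x < 1 / 2 / 2), E y := by
          refine Finset.sum_le_sum fun y hy => Real.exp_le_exp.2 ?_
          simp only [Finset.mem_filter, Finset.mem_univ, true_and] at hy
          nlinarith
      _ ≤ Z := Finset.sum_le_sum_of_subset_of_nonneg hsub fun y _ _ => (hEpos y).le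
  have hcard : (F.card : ℝ) ≤ 2 ^ D * (2 ^ D *
      (Finset.univ.filter fun x => ρ x < 1 / 2 / 2).card) := by
    refine (hd.card_le one_pos le_rfl).trans ?_
    gcongr
    exact hd.card_le (η := 1 / 2) (by norm_num) (by norm_num)
  have hcF : c * F.card ≤ Z / 2 := by
    have h2D : (2 : ℝ) ^ D ≤ Real.exp D := by
      rw [Real.rpow_def_of_pos (by norm_num)]
      apply Real.exp_le_exp.2
      have := Real.log_two_lt_d9
      nlinarith
    have hN0 : (0 : ℝ) ≤ (Finset.univ.filter fun x => ρ x < 1 / 2 / 2).card := by positivity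
    set N : ℝ := ((Finset.univ.filter fun x => ρ x < 1 / 2 / 2).card : ℝ)
    calc c * F.card ≤ c * (Real.exp D * (Real.exp D * N)) := by
          gcongr
          exact hcard.trans (by gcongr)
      _ = (N * Real.exp (-K / 4)) * Real.exp (-(3 * D)) := by
          have : c * (Real.exp D * Real.exp D) = Real.exp (-K / 4) * Real.exp (-(3 * D)) := by
            rw [hc, ← Real.exp_add, ← Real.exp_add, ← Real.exp_add, hK]
            ring_nf
          linear_combination N * this
      _ ≤ (N * Real.exp (-K / 4)) * (1 / 2) := by
          gcongr
          have h1 : Real.exp (-(3 * D)) ≤ Real.exp (-1) := Real.exp_le_exp.2 (by linarith)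
          have h2 : Real.exp (-1) ≤ 1 / 2 := by
            have := Real.exp_one_gt_d9
            rw [Real.exp_neg, inv_le_comm₀ (Real.exp_pos _) (by norm_num)]
            norm_num; linarith
          linarith
      _ ≤ Z / 2 := by linarith
  have hFne : (0 : G) ∈ F := by simp [hF, h.zero]
  have hZpos : 0 < Z := Finset.sum_pos (fun y _ => hEpos y) ⟨0, hFne⟩
  have e14 : (1 : ℝ) ≤ Real.exp (1 / 4) := Real.one_le_exp (by norm_num)
  have hT1 : Z / 2 ≤ T 1 := by
    rw [hTF 1 e14]
    have : ∑ y ∈ F, (E y - c) ≤ ∑ y ∈ F, W 1 y :=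
      Finset.sum_le_sum fun y _ => by simp [hW]
    rw [Finset.sum_sub_distrib, Finset.sum_const, nsmul_eq_mul] at this
    have h3 : (F.card : ℝ) * c = c * F.card := mul_comm _ _
    have h4 : ∑ y ∈ F, E y = Z := rfl
    linarith
  have hT1pos : 0 < T 1 := by linarith
  refine ⟨fun y => W 1 y / T 1, isProb_normalize (hW0 1) hT1pos, ?_, ?_⟩
  · intro y hy
    by_contra hcon
    apply hy
    simp only
    rw [hsupp 1 e14 y (by simpa [hF] using hcon), zero_div]
  · intro η hη0 hη1
    set tp := Real.exp (η / 4) with htp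
    set tm := Real.exp (-(η / 4)) with htm
    have htp1 : 1 ≤ tp := Real.one_le_exp (by positivity)
    have htp2 : tp ≤ Real.exp (1 / 4) := Real.exp_le_exp.2 (by linarith)
    have htm1 : tm ≤ 1 := Real.exp_le_one_iff.2 (by linarith)
    have htm0 : 1 - η / 4 ≤ tm := by
      have := Real.add_one_le_exp (-(η / 4)); linarith
    have htp3 : tp ≤ 1 + η / 2 := by
      have h1 := Real.abs_exp_sub_one_le (x := η / 4) (by rw [abs_of_pos (by positivity)]; linarith)
      rw [abs_of_pos (show (0 : ℝ) < η / 4 by positivity)] at h1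
      have := (abs_le.1 h1).2
      linarith
    have hTp : T tp ≤ (1 + η) * T 1 := by
      have : T tp ≤ T 1 + (η / 2) * Z := by
        rw [hTF tp htp2, hTF 1 e14, hZ, Finset.mul_sum, ← Finset.sum_add_distrib]
        refine Finset.sum_le_sum fun y _ => ?_
        have hp := hEpos y
        refine max_le ?_ ?_
        · have : 1 * E y - c ≤ W 1 y := le_max_left _ _
          nlinarith
        · have := hW0 1 y
          positivity
      nlinarith
    have hTm : (1 - η) * T 1 ≤ T tm := by
      have : T 1 ≤ T tm + (η / 4) * Z := by
        rw [hTF tm (htm1.trans e14), hTF 1 e14, hZ, Finset.mul_sum, ← Finset.sum_add_distrib]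
        refine Finset.sum_le_sum fun y _ => ?_
        have hp := hEpos y
        refine max_le ?_ ?_
        · have : tm * E y - c ≤ W tm y := le_max_left _ _
          nlinarith
        · have := hW0 tm y
          positivity
      nlinarith
    have hTm' : T 1 / 2 ≤ T tm := by
      have : T 1 ≤ T tm + (η / 4) * Z := by
        rw [hTF tm (htm1.trans e14), hTF 1 e14, hZ, Finset.mul_sum, ← Finset.sum_add_distrib]
        refine Finset.sum_le_sum fun y _ => ?_
        have hp := hEpos y
        refine max_le ?_ ?_
        · have : tm * E y - c ≤ W tm y := le_max_left _ _
          nlinarith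
        · have := hW0 tm y
          positivity
      nlinarith
    have hTmpos : 0 < T tm := by linarith
    have hTppos : 0 < T tp := by
      refine hT1pos.trans_le (Finset.sum_le_sum fun y _ => ?_)
      have hp := hEpos y
      refine max_le_max ?_ le_rfl
      nlinarith
    refine ⟨fun y => W tp y / T tp, fun y => W tm y / T tm, isProb_normalize (hW0 tp) hTppos,
      isProb_normalize (hW0 tm) hTmpos, ?_⟩
    intro x hx y
    have hx' : K * ρ x < η / 4 := by
      have : ρ x < η / (80 * D) := hx
      rw [lt_div_iff₀ (by positivity)] at this
      rw [hK]; linarith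
    have hxy1 : ρ y ≤ ρ (y - x) + ρ x := by simpa using h.add (y - x) x
    have hxy2 : ρ (y - x) ≤ ρ y + ρ x := by
      have := h.add y (-x)
      rwa [h.neg, ← sub_eq_add_neg] at this
    have hE1 : E (y - x) ≤ tp * E y := by
      rw [htp, hE]; simp only
      rw [← Real.exp_add]
      apply Real.exp_le_exp.2
      nlinarith
    have hE2 : tm * E y ≤ E (y - x) := by
      rw [htm, hE]; simp only
      rw [← Real.exp_add]
      apply Real.exp_le_exp.2
      nlinarith
    have hW1 : W 1 (y - x) ≤ W tp y := by
      simp only [hW]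
      have : 1 * E (y - x) - c ≤ tp * E y - c := by rw [one_mul]; exact sub_le_sub_right hE1 c
      exact max_le_max this le_rfl
    have hW2 : W tm y ≤ W 1 (y - x) := by
      simp only [hW]
      have : tm * E y - c ≤ 1 * E (y - x) - c := by rw [one_mul]; exact sub_le_sub_right hE2 c
      exact max_le_max this le_rfl
    constructor
    · calc (1 - η) * (W tm y / T tm) = ((1 - η) / T tm) * W tm y := by ring
        _ ≤ (1 / T 1) * W tm y := by
            have := hW0 tm y
            gcongr ?_ * _
            rw [div_le_div_iff₀ hTmpos hT1pos]; linarith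
        _ ≤ (1 / T 1) * W 1 (y - x) := by gcongr
        _ = _ := by ring
    · calc W 1 (y - x) / T 1 ≤ W tp y / T 1 := by gcongr
        _ = (1 / T 1) * W tp y := by ring
        _ ≤ ((1 + η) / T tp) * W tp y := by
            have := hW0 tp y
            gcongr ?_ * _
            rw [div_le_div_iff₀ hT1pos hTppos]; linarith
        _ = _ := by ring

lemma approxInv_char {F : ℝ → Set G} {w : G → ℝ} (hw : ApproxInvariant F w) {η : ℝ} (h0 : 0 < η)
    (h1 : η ≤ 1) (hF : (0 : G) ∈ F η) {x : G} (hx : x ∈ F η) (χ : AddChar G ℂ) :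
    ‖∑ y, (w y : ℂ) * χ y‖ * ‖1 - χ x‖ ≤ 2 * η := by
  obtain ⟨wp, wm, hp, hm, hinv⟩ := hw η h0 h1
  have e1 : (∑ y, (w y : ℂ) * χ y) * (χ x - 1) = ∑ y, ((w (y - x) : ℂ) - w y) * χ y := by
    have : ∑ y, (w (y - x) : ℂ) * χ y = ∑ y, (w y : ℂ) * (χ y * χ x) := by
      rw [← Equiv.sum_comp (Equiv.addRight x)]
      refine Finset.sum_congr rfl fun y _ => ?_
      simp [AddChar.map_add_eq_mul]
    simp only [sub_mul, Finset.sum_sub_distrib, this, mul_sub, Finset.sum_mul, mul_one, mul_assoc]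
  rw [← norm_sub_rev, ← norm_mul, e1]
  refine (norm_sum_le _ _).trans ?_
  calc ∑ y, ‖((w (y - x) : ℂ) - w y) * χ y‖ ≤ ∑ y, ((1 + η) * wp y - (1 - η) * wm y) := by
        refine Finset.sum_le_sum fun y _ => ?_
        rw [norm_mul, char_norm, mul_one, ← Complex.ofReal_sub, Complex.norm_real, Real.norm_eq_abs,
          abs_le]
        have h2 := hinv x hx y
        have h3 := hinv 0 hF y
        rw [sub_zero] at h3
        constructor <;> linarith [h2.1, h2.2, h3.1, h3.2]
    _ = 2 * η := by
        rw [Finset.sum_sub_distrib, ← Finset.mul_sum, ← Finset.mul_sum, hp.2, hm.2]; ring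

/-- convolution powers -/
lemma exists_power {ρ : G → ℝ} (h : IsBN ρ) {w : G → ℝ} (hw : IsProb w) {r : ℝ}
    (hr : ∀ y, w y ≠ 0 → ρ y ≤ r) (m : ℕ) :
    ∃ v : G → ℝ, IsProb v ∧ (∀ y, v y ≠ 0 → ρ y ≤ m * r) ∧
      ∀ χ : AddChar G ℂ, ∑ y, (v y : ℂ) * χ y = (∑ y, (w y : ℂ) * χ y) ^ m := by
  classical
  induction m with
  | zero =>
    refine ⟨fun y => if y = 0 then 1 else 0, ⟨fun y => by simp only; split_ifs <;> norm_num, by simp⟩, ?_, ?_⟩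
    · intro y hy
      have : y = 0 := by by_contra hne; simp [hne] at hy
      simp [this, h.zero]
    · intro χ
      rw [Finset.sum_eq_single 0]
      · simp
      · intro b _ hb; simp [hb]
      · simp
  | succ m ih =>
    obtain ⟨v, hv, hs, hχ⟩ := ih
    refine ⟨fun y => ∑ z, v (y - z) * w z, ⟨fun y => Finset.sum_nonneg fun z _ =>
      mul_nonneg (hv.1 _) (hw.1 _), ?_⟩, ?_, ?_⟩
    · rw [Finset.sum_comm]
      have : ∀ z, ∑ y, v (y - z) * w z = w z := by
        intro z
        rw [← Finset.sum_mul, ← Equiv.sum_comp (Equiv.addRight z)]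
        simp [hv.2]
      simp only [this, hw.2]
    · intro y hy
      obtain ⟨z, -, hz⟩ := Finset.exists_ne_zero_of_sum_ne_zero hy
      have h1 := hs _ (left_ne_zero_of_mul hz)
      have h2 := hr _ (right_ne_zero_of_mul hz)
      have h3 : ρ y ≤ ρ (y - z) + ρ z := by simpa using h.add (y - z) z
      push_cast; linarith
    · intro χ
      rw [pow_succ, ← hχ]
      calc ∑ y, ((∑ z, v (y - z) * w z : ℝ) : ℂ) * χ y
          = ∑ y, ∑ z, (v (y - z) : ℂ) * w z * χ y := by
            refine Finset.sum_congr rfl fun y _ => ?_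
            push_cast
            rw [Finset.sum_mul]
        _ = ∑ z, ∑ y, (v (y - z) : ℂ) * w z * χ y := Finset.sum_comm
        _ = ∑ z, (∑ y, (v y : ℂ) * χ y) * (w z * χ z) := by
            refine Finset.sum_congr rfl fun z _ => ?_
            rw [← Equiv.sum_comp (Equiv.addRight z), Finset.sum_mul]
            refine Finset.sum_congr rfl fun y _ => ?_
            simp only [Equiv.coe_addRight, add_sub_cancel_right, AddChar.map_add_eq_mul]
            ring
        _ = _ := by rw [Finset.mul_sum]

end inv

section dual
variable {G : Type} [AddCommGroup G] [Fintype G]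
set_option linter.unusedSectionVars false

lemma LpW_nonneg {p : ℝ} {ν : G → ℝ} (hν : ∀ y, 0 ≤ ν y) (F : G → ℂ) : 0 ≤ LpW p ν F :=
  Real.rpow_nonneg (Finset.sum_nonneg fun y _ => mul_nonneg (hν y) (by positivity)) _

lemma holder_unit {p : ℝ} (hp : 2 ≤ p) {ν : G → ℝ} (hν : ∀ y, 0 ≤ ν y) (h : G → ℝ)
    (h0 : ∀ y, 0 ≤ h y) (h1 : ∑ y, ν y * h y ^ (p / (p - 1)) ≤ 1) (F : G → ℂ) :
    ∑ y, ν y * h y * ‖F y‖ ≤ LpW p ν F := by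
  have hp0 : 0 < p := by linarith
  have hp1 : 0 < p - 1 := by linarith
  set q := p / (p - 1) with hq
  have hq0 : 0 < q := by positivity
  have hpq : p.HolderConjugate q := Real.HolderConjugate.conjExponent (by linarith)
  have hH := Real.inner_le_Lp_mul_Lq_of_nonneg (Finset.univ : Finset G)
    (f := fun y => ν y ^ (1 / p) * ‖F y‖) (g := fun y => ν y ^ (1 / q) * h y) hpq
    (fun y _ => mul_nonneg (Real.rpow_nonneg (hν y) _) (norm_nonneg _))
    (fun y _ => mul_nonneg (Real.rpow_nonneg (hν y) _) (h0 y))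
  have e1 : ∀ y, (ν y ^ (1 / p) * ‖F y‖) ^ p = ν y * ‖F y‖ ^ p := by
    intro y
    rw [Real.mul_rpow (Real.rpow_nonneg (hν y) _) (norm_nonneg _), ← Real.rpow_mul (hν y),
      one_div_mul_cancel hp0.ne', Real.rpow_one]
  have e2 : ∀ y, (ν y ^ (1 / q) * h y) ^ q = ν y * h y ^ q := by
    intro y
    rw [Real.mul_rpow (Real.rpow_nonneg (hν y) _) (h0 y), ← Real.rpow_mul (hν y),
      one_div_mul_cancel hq0.ne', Real.rpow_one]
  have e3 : ∀ y, ν y ^ (1 / p) * ‖F y‖ * (ν y ^ (1 / q) * h y) = ν y * h y * ‖F y‖ := by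
    intro y
    have : ν y ^ (1 / p) * ν y ^ (1 / q) = ν y := by
      rw [← Real.rpow_add' (hν y)]
      · rw [show 1 / p + 1 / q = 1 by simpa using hpq.inv_add_inv_eq_one, Real.rpow_one]
      · rw [show 1 / p + 1 / q = 1 by simpa using hpq.inv_add_inv_eq_one]; norm_num
    linear_combination (‖F y‖ * h y) * this
  simp only [e1, e2, e3] at hH
  refine hH.trans ?_
  have h3 : (∑ y, ν y * h y ^ q) ^ (1 / q) ≤ 1 :=
    Real.rpow_le_one (Finset.sum_nonneg fun y _ => mul_nonneg (hν y) (Real.rpow_nonneg (h0 y) _))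
      h1 (by positivity)
  calc _ ≤ (∑ y, ν y * ‖F y‖ ^ p) ^ (1 / p) * 1 := by
        apply mul_le_mul_of_nonneg_left h3 (LpW_nonneg hν F)
    _ = _ := by rw [mul_one]; rfl

lemma dual {p : ℝ} (hp : 2 ≤ p) {ν : G → ℝ} (hν : ∀ y, 0 ≤ ν y) (g : G → ℂ) :
    ∃ H : G → ℂ, ∑ y, (ν y : ℂ) * H y * g y = (LpW p ν g : ℂ) ∧
      ∀ F : G → ℂ, ‖∑ y, (ν y : ℂ) * H y * F y‖ ≤ LpW p ν F := by
  have hp0 : 0 < p := by linarith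
  have hp1 : 0 < p - 1 := by linarith
  set S := ∑ y, ν y * ‖g y‖ ^ p with hS
  have hS0 : 0 ≤ S := Finset.sum_nonneg fun y _ => mul_nonneg (hν y) (by positivity)
  set N := LpW p ν g with hN
  have hNS : N = S ^ (1 / p) := rfl
  rcases hS0.eq_or_lt with h0 | hSpos
  · refine ⟨0, ?_, fun F => by simpa using LpW_nonneg hν F⟩
    rw [hNS, ← h0, Real.zero_rpow (by positivity)]
    simp
  have hNpos : 0 < N := Real.rpow_pos_of_pos hSpos _
  have hNp : N ^ p = S := by
    rw [hNS, ← Real.rpow_mul hS0, one_div_mul_cancel hp0.ne', Real.rpow_one]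
  have hgp : ∀ y, ‖g y‖ * ‖g y‖ ^ (p - 2) = ‖g y‖ ^ (p - 1) := by
    intro y
    rw [show p - 1 = 1 + (p - 2) by ring, Real.rpow_add' (norm_nonneg _) (by linarith), Real.rpow_one]
  have hgp2 : ∀ y, ‖g y‖ * ‖g y‖ ^ (p - 1) = ‖g y‖ ^ p := by
    intro y
    conv_rhs => rw [show p = 1 + (p - 1) by ring]
    rw [Real.rpow_add' (norm_nonneg _) (by linarith), Real.rpow_one]
  refine ⟨fun y => (starRingEnd ℂ) (g y) * ((‖g y‖ ^ (p - 2) / N ^ (p - 1) : ℝ) : ℂ), ?_, ?_⟩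
  · have e : ∀ y, (ν y : ℂ) * ((starRingEnd ℂ) (g y) * ((‖g y‖ ^ (p - 2) / N ^ (p - 1) : ℝ) : ℂ)) * g y
        = ((ν y * ‖g y‖ ^ p / N ^ (p - 1) : ℝ) : ℂ) := by
      intro y
      have h1 : (starRingEnd ℂ) (g y) * g y = ((‖g y‖ ^ 2 : ℝ) : ℂ) := by
        rw [mul_comm, Complex.mul_conj, Complex.normSq_eq_norm_sq]
      have h2 : ‖g y‖ ^ p = ‖g y‖ ^ 2 * ‖g y‖ ^ (p - 2) := by
        rw [← hgp2, ← hgp]; ring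
      rw [h2]
      push_cast at h1 ⊢
      linear_combination ((ν y : ℂ) * ((‖g y‖ ^ (p - 2) : ℝ) : ℂ) / ((N ^ (p - 1) : ℝ) : ℂ)) * h1
    simp only [e]
    rw [← Complex.ofReal_sum, ← Finset.sum_div]
    congr 1
    rw [← hS, ← hNp, Real.rpow_sub hNpos, Real.rpow_one]
    have := Real.rpow_pos_of_pos hNpos p
    field_simp
  · intro F
    refine (norm_sum_le _ _).trans ?_
    have hb : ∀ y, 0 ≤ ‖g y‖ ^ (p - 1) / N ^ (p - 1) := fun y => by positivity
    refine le_trans (le_of_eq ?_) (holder_unit hp hν (fun y => ‖g y‖ ^ (p - 1) / N ^ (p - 1)) hb ?_ F)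
    · refine Finset.sum_congr rfl fun y _ => ?_
      rw [norm_mul, norm_mul, norm_mul, Complex.norm_real, Complex.norm_real, RCLike.norm_conj,
        Real.norm_of_nonneg (hν y), Real.norm_of_nonneg (by positivity), ← hgp]
      ring
    · have e : ∀ y, ν y * (‖g y‖ ^ (p - 1) / N ^ (p - 1)) ^ (p / (p - 1)) = ν y * ‖g y‖ ^ p / S := by
        intro y
        rw [Real.div_rpow (by positivity) (by positivity), ← Real.rpow_mul (norm_nonneg _),
          ← Real.rpow_mul hNpos.le, mul_div_cancel₀ _ hp1.ne', hNp]
        ring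
      simp only [e]
      rw [← Finset.sum_div, ← hS, div_self hSpos.ne']

end dual

section rudin
variable {G : Type} [AddCommGroup G] [Fintype G]

lemma sum_signType {M : Type*} [AddCommMonoid M] (f : SignType → M) :
    ∑ s, f s = f 0 + (f (-1) + f 1) := by
  have : (Finset.univ : Finset SignType) = {0, -1, 1} := by decide
  rw [this, Finset.sum_insert (by decide), Finset.sum_insert (by decide), Finset.sum_singleton]

lemma rudin_exp {ι : Type*} [Fintype ι] [DecidableEq ι] (lam : ι → AddChar G ℂ) (c : ι → ℂ)
    (hc : ∀ i, ‖c i‖ ≤ 1) {ν : G → ℝ} (hν : IsProb ν) {t τ : ℝ} (ht : 0 ≤ t) (hτ0 : 0 ≤ τ)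
    (hdis : ∀ m : ι → SignType, m ≠ 0 → ‖∑ y, (ν y : ℂ) * ∏ i, (lam i y) ^ (m i : ℤ)‖ ≤ τ)
    (hτ : τ * Real.exp (t * Fintype.card ι) ≤ 1) :
    ∑ y, ν y * Real.exp (t * (∑ i, c i * lam i y).re) ≤
      2 * Real.exp (t ^ 2 * Fintype.card ι / 2) := by
  classical
  set a : ι → SignType → ℂ := fun i s => if s = 0 then (Real.cosh t : ℂ) else
    if s = 1 then (Real.sinh t : ℂ) / 2 * c i else (Real.sinh t : ℂ) / 2 * (starRingEnd ℂ) (c i) with ha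
  have hs0 : 0 ≤ Real.sinh t := Real.sinh_nonneg_iff.2 ht
  have hu : ∀ i y, |(c i * lam i y).re| ≤ 1 := by
    intro i y
    refine (Complex.abs_re_le_norm _).trans ?_
    rw [norm_mul, char_norm, mul_one]; exact hc i
  have hexp : ∀ y, Real.exp (t * (∑ i, c i * lam i y).re) ≤
      ∏ i, (Real.cosh t + (c i * lam i y).re * Real.sinh t) := by
    intro y
    rw [Complex.re_sum, Finset.mul_sum, Real.exp_sum]
    refine Finset.prod_le_prod (fun i _ => (Real.exp_pos _).le) fun i _ => ?_
    rw [mul_comm t]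
    exact Real.exp_mul_le_cosh_add_mul_sinh (hu i y) t
  have hfac : ∀ y i, ((Real.cosh t + (c i * lam i y).re * Real.sinh t : ℝ) : ℂ) =
      ∑ s : SignType, a i s * (lam i y) ^ (s : ℤ) := by
    intro y i
    rw [sum_signType]
    have hinv : (lam i y)⁻¹ = (starRingEnd ℂ) (lam i y) := by
      rw [Complex.inv_def, Complex.normSq_eq_norm_sq, char_norm]; simp
    have hre : (((c i * lam i y).re : ℝ) : ℂ) =
        (c i * lam i y + (starRingEnd ℂ) (c i * lam i y)) / 2 := by
      rw [Complex.re_eq_add_conj]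
    have e1 : a i 0 = (Real.cosh t : ℂ) := by simp [ha]
    have e2 : a i 1 = (Real.sinh t : ℂ) / 2 * c i := by simp [ha]
    have e3 : a i (-1) = (Real.sinh t : ℂ) / 2 * (starRingEnd ℂ) (c i) := by
      simp only [ha]; rw [if_neg (by decide), if_neg (by decide)]
    rw [e1, e2, e3, Complex.ofReal_add, Complex.ofReal_mul, hre]
    simp only [SignType.coe_zero, SignType.coe_one, SignType.coe_neg, zpow_zero, zpow_one, zpow_neg,
      hinv, map_mul]
    ring
  have hprod : ∀ y, ((∏ i, (Real.cosh t + (c i * lam i y).re * Real.sinh t) : ℝ) : ℂ) =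
      ∑ m : ι → SignType, (∏ i, a i (m i)) * ∏ i, (lam i y) ^ (m i : ℤ) := by
    intro y
    rw [Complex.ofReal_prod]
    simp only [hfac, ← Finset.prod_mul_distrib]
    rw [Finset.prod_univ_sum, Fintype.piFinset_univ]
  have hmain : ((∑ y, ν y * ∏ i, (Real.cosh t + (c i * lam i y).re * Real.sinh t) : ℝ) : ℂ) =
      ∑ m : ι → SignType, (∏ i, a i (m i)) * ∑ y, (ν y : ℂ) * ∏ i, (lam i y) ^ (m i : ℤ) := by
    rw [Complex.ofReal_sum]
    simp only [Complex.ofReal_mul, hprod, Finset.mul_sum]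
    rw [Finset.sum_comm]
    refine Finset.sum_congr rfl fun m _ => Finset.sum_congr rfl fun y _ => ?_
    ring
  have hanorm : ∀ i, ∑ s, ‖a i s‖ ≤ Real.exp t := by
    intro i
    rw [sum_signType]
    have e1 : ‖a i 0‖ = Real.cosh t := by
      simp only [ha, if_true]; rw [Complex.norm_real, Real.norm_of_nonneg (Real.cosh_pos t).le]
    have e2 : ‖a i 1‖ ≤ Real.sinh t / 2 := by
      have : a i 1 = (Real.sinh t : ℂ) / 2 * c i := by simp [ha]
      rw [this, norm_mul, norm_div, Complex.norm_real, Real.norm_of_nonneg hs0]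
      simpa using mul_le_mul_of_nonneg_left (hc i) (by positivity : 0 ≤ Real.sinh t / 2)
    have e3 : ‖a i (-1)‖ ≤ Real.sinh t / 2 := by
      have : a i (-1) = (Real.sinh t : ℂ) / 2 * (starRingEnd ℂ) (c i) := by
        simp only [ha]; rw [if_neg (by decide), if_neg (by decide)]
      rw [this, norm_mul, norm_div, Complex.norm_real, Real.norm_of_nonneg hs0, RCLike.norm_conj]
      simpa using mul_le_mul_of_nonneg_left (hc i) (by positivity : 0 ≤ Real.sinh t / 2)
    have := Real.cosh_add_sinh t
    linarith
  have hsum : ∑ m : ι → SignType, ∏ i, ‖a i (m i)‖ ≤ Real.exp (t * Fintype.card ι) := by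
    have : ∑ m : ι → SignType, ∏ i, ‖a i (m i)‖ = ∏ i, ∑ s, ‖a i s‖ := by
      rw [Finset.prod_univ_sum, Fintype.piFinset_univ]
    rw [this]
    calc _ ≤ ∏ i : ι, Real.exp t := Finset.prod_le_prod
          (fun i _ => Finset.sum_nonneg fun s _ => norm_nonneg _) fun i _ => hanorm i
      _ = _ := by rw [Finset.prod_const, Finset.card_univ, ← Real.exp_nat_mul, mul_comm]
  have hcosh : ∏ i : ι, ‖a i 0‖ ≤ Real.exp (t ^ 2 * Fintype.card ι / 2) := by
    calc ∏ i : ι, ‖a i 0‖ ≤ ∏ i : ι, Real.exp (t ^ 2 / 2) := by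
          refine Finset.prod_le_prod (fun i _ => norm_nonneg _) fun i _ => ?_
          simp only [ha, if_true]; rw [Complex.norm_real, Real.norm_of_nonneg (Real.cosh_pos t).le]
          exact Real.cosh_le_exp_half_sq t
      _ = _ := by rw [Finset.prod_const, Finset.card_univ, ← Real.exp_nat_mul]; ring_nf
  have hν1 : ‖∑ y, (ν y : ℂ)‖ = 1 := by
    rw [← Complex.ofReal_sum, hν.2]; simp
  calc ∑ y, ν y * Real.exp (t * (∑ i, c i * lam i y).re)
      ≤ ∑ y, ν y * ∏ i, (Real.cosh t + (c i * lam i y).re * Real.sinh t) :=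
        Finset.sum_le_sum fun y _ => mul_le_mul_of_nonneg_left (hexp y) (hν.1 y)
    _ ≤ ‖((∑ y, ν y * ∏ i, (Real.cosh t + (c i * lam i y).re * Real.sinh t) : ℝ) : ℂ)‖ := by
        rw [Complex.norm_real]; exact le_abs_self _
    _ ≤ ∑ m : ι → SignType, ((if m = 0 then ∏ i, ‖a i 0‖ else 0) + τ * ∏ i, ‖a i (m i)‖) := by
        rw [hmain]
        refine (norm_sum_le _ _).trans (Finset.sum_le_sum fun m _ => ?_)
        rw [norm_mul, norm_prod]
        have hpn : 0 ≤ ∏ i, ‖a i (m i)‖ := Finset.prod_nonneg fun i _ => norm_nonneg _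
        split_ifs with hm
        · subst hm
          simp only [Pi.zero_apply, SignType.coe_zero, zpow_zero, Finset.prod_const_one, mul_one, hν1]
          have := mul_nonneg hτ0 hpn
          simp only [Pi.zero_apply] at this
          linarith
        · rw [zero_add, mul_comm τ]
          exact mul_le_mul_of_nonneg_left (hdis m hm) hpn
    _ = ∏ i, ‖a i 0‖ + τ * ∑ m : ι → SignType, ∏ i, ‖a i (m i)‖ := by
        rw [Finset.sum_add_distrib, Finset.mul_sum]; simp
    _ ≤ Real.exp (t ^ 2 * Fintype.card ι / 2) + τ * Real.exp (t * Fintype.card ι) := by gcongr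
    _ ≤ _ := by
        have : 1 ≤ Real.exp (t ^ 2 * Fintype.card ι / 2) := Real.one_le_exp (by positivity)
        linarith

end rudin

section chang
variable {G : Type} [AddCommGroup G] [Fintype G]

lemma eight_exp_le {p : ℝ} (hp : 2 ≤ p) : 8 * Real.exp (p / 2) ≤ 5 ^ p := by
  have h1 : Real.exp (1 / 2) ≤ 5 / 3 := by
    have h : Real.exp (1 / 2) ^ 2 = Real.exp 1 := by
      rw [← Real.exp_nat_mul]; norm_num
    have := Real.exp_one_lt_d9
    nlinarith [Real.exp_pos (1 / 2 : ℝ)]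
  have h2 : Real.exp (p / 2) ≤ (5 / 3 : ℝ) ^ p := by
    calc Real.exp (p / 2) = Real.exp (1 / 2) ^ p := by rw [← Real.exp_mul]; ring_nf
      _ ≤ _ := Real.rpow_le_rpow (Real.exp_pos _).le h1 (by linarith)
  have h3 : (8 : ℝ) ≤ 3 ^ p := by
    calc (8 : ℝ) ≤ 3 ^ (2 : ℝ) := by norm_num
      _ ≤ _ := Real.rpow_le_rpow_of_exponent_le (by norm_num) hp
  calc 8 * Real.exp (p / 2) ≤ 3 ^ p * (5 / 3 : ℝ) ^ p := by gcongr
    _ = 5 ^ p := by rw [← Real.mul_rpow (by norm_num) (by norm_num)]; norm_num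

lemma norm_rpow_le_exp {p t : ℝ} (hp : 2 ≤ p) (ht : 0 < t) (z : ℂ) :
    ‖z‖ ^ p ≤ (2 * p / t) ^ p * (Real.exp (t * z.re) + Real.exp (t * (-z).re) +
      Real.exp (t * (-Complex.I * z).re) + Real.exp (t * (Complex.I * z).re)) := by
  have hp0 : 0 < p := by linarith
  have key : ∀ u : ℝ, 0 ≤ u → ‖z‖ ≤ 2 * u → ‖z‖ ^ p ≤ (2 * p / t) ^ p * Real.exp (t * u) := by
    intro u hu hz
    have h1 : t * u / p ≤ Real.exp (t * u / p) := by
      linarith [Real.add_one_le_exp (t * u / p)]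
    calc ‖z‖ ^ p ≤ ((2 * p / t) * Real.exp (t * u / p)) ^ p := by
          refine Real.rpow_le_rpow (norm_nonneg _) (hz.trans ?_) hp0.le
          calc 2 * u = (2 * p / t) * (t * u / p) := by field_simp
            _ ≤ _ := by gcongr
      _ = _ := by
          rw [Real.mul_rpow (by positivity) (Real.exp_pos _).le, ← Real.exp_mul]
          congr 2; field_simp
  have hn := Complex.norm_le_abs_re_add_abs_im z
  have e1 : (-Complex.I * z).re = z.im := by simp
  have e2 : (Complex.I * z).re = -z.im := by simp
  have hpos : 0 ≤ (2 * p / t) ^ p := by positivity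
  rw [e1, e2, Complex.neg_re]
  have q1 := (Real.exp_pos (t * z.re)).le
  have q2 := (Real.exp_pos (t * -z.re)).le
  have q3 := (Real.exp_pos (t * z.im)).le
  have q4 := (Real.exp_pos (t * -z.im)).le
  rcases le_total |z.re| |z.im| with h | h
  · refine (key |z.im| (abs_nonneg _) (by linarith)).trans (mul_le_mul_of_nonneg_left ?_ hpos)
    rcases abs_choice z.im with h' | h' <;> rw [h'] <;> linarith
  · refine (key |z.re| (abs_nonneg _) (by linarith)).trans (mul_le_mul_of_nonneg_left ?_ hpos)
    rcases abs_choice z.re with h' | h' <;> rw [h'] <;> linarith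

lemma rudin_Lp {ι : Type*} [Fintype ι] [DecidableEq ι] (lam : ι → AddChar G ℂ) (c : ι → ℂ)
    (hc : ∀ i, ‖c i‖ ≤ 1) {ν : G → ℝ} (hν : IsProb ν) {p τ : ℝ} (hp : 2 ≤ p) (hτ0 : 0 ≤ τ)
    (hk : 0 < Fintype.card ι)
    (hdis : ∀ m : ι → SignType, m ≠ 0 → ‖∑ y, (ν y : ℂ) * ∏ i, (lam i y) ^ (m i : ℤ)‖ ≤ τ)
    (hτ : τ * Real.exp (√(p * Fintype.card ι)) ≤ 1) :
    LpW p ν (fun y => ∑ i, c i * lam i y) ≤ 10 * √(p * Fintype.card ι) := by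
  set k : ℝ := ((Fintype.card ι : ℕ) : ℝ) with hkdef
  have hk0 : 0 < k := by simpa [hkdef] using hk
  have hp0 : 0 < p := by linarith
  set R := √(p * k) with hR
  have hR0 : 0 < R := Real.sqrt_pos.2 (by positivity)
  have hR2 : R * R = p * k := Real.mul_self_sqrt (by positivity)
  set t := R / k with ht
  have ht0 : 0 < t := by positivity
  have htk : t * k = R := by rw [ht]; field_simp
  have ht2 : t ^ 2 * k / 2 = p / 2 := by
    rw [ht]; field_simp; nlinarith
  have hpt : 2 * p / t = 2 * R := by
    rw [ht]; field_simp; nlinarith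
  have hb : ∀ u : ℂ, ‖u‖ ≤ 1 →
      ∑ y, ν y * Real.exp (t * (u * ∑ i, c i * lam i y).re) ≤ 2 * Real.exp (p / 2) := by
    intro u hu
    have := rudin_exp lam (fun i => u * c i)
      (fun i => by rw [norm_mul]; exact mul_le_one₀ hu (norm_nonneg _) (hc i)) hν ht0.le hτ0 hdis
      (by rw [← hkdef, htk]; exact hτ)
    rw [← hkdef, ht2] at this
    simpa only [Finset.mul_sum, mul_assoc] using this
  have b1 := hb 1 (by simp)
  have b2 := hb (-1) (by simp)
  have b3 := hb (-Complex.I) (by simp)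
  have b4 := hb Complex.I (by simp)
  have hsum : ∑ y, ν y * ‖∑ i, c i * lam i y‖ ^ p ≤ (10 * R) ^ p := by
    calc ∑ y, ν y * ‖∑ i, c i * lam i y‖ ^ p
        ≤ ∑ y, ν y * ((2 * p / t) ^ p * (Real.exp (t * (1 * ∑ i, c i * lam i y).re) +
          Real.exp (t * (-1 * ∑ i, c i * lam i y).re) +
          Real.exp (t * (-Complex.I * ∑ i, c i * lam i y).re) +
          Real.exp (t * (Complex.I * ∑ i, c i * lam i y).re))) := by
          refine Finset.sum_le_sum fun y _ => mul_le_mul_of_nonneg_left ?_ (hν.1 y)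
          have := norm_rpow_le_exp hp ht0 (∑ i, c i * lam i y)
          rw [one_mul, neg_one_mul]
          exact this
      _ = (2 * p / t) ^ p * (∑ y, ν y * Real.exp (t * (1 * ∑ i, c i * lam i y).re) +
          ∑ y, ν y * Real.exp (t * (-1 * ∑ i, c i * lam i y).re) +
          ∑ y, ν y * Real.exp (t * (-Complex.I * ∑ i, c i * lam i y).re) +
          ∑ y, ν y * Real.exp (t * (Complex.I * ∑ i, c i * lam i y).re)) := by
          rw [← Finset.sum_add_distrib, ← Finset.sum_add_distrib, ← Finset.sum_add_distrib,
            Finset.mul_sum]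
          refine Finset.sum_congr rfl fun y _ => by ring
      _ ≤ (2 * p / t) ^ p * (8 * Real.exp (p / 2)) := by
          refine mul_le_mul_of_nonneg_left (by linarith) (by positivity)
      _ ≤ (2 * R) ^ p * 5 ^ p := by
          rw [hpt]
          exact mul_le_mul_of_nonneg_left (eight_exp_le hp) (by positivity)
      _ = _ := by
          rw [← Real.mul_rpow (by positivity) (by norm_num)]; ring_nf
  calc LpW p ν (fun y => ∑ i, c i * lam i y) ≤ ((10 * R) ^ p) ^ (1 / p) :=
        Real.rpow_le_rpow (Finset.sum_nonneg fun y _ => mul_nonneg (hν.1 y) (by positivity)) hsum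
          (by positivity)
    _ = 10 * R := by
        rw [← Real.rpow_mul (by positivity), mul_one_div_cancel hp0.ne', Real.rpow_one]

/-- Dissociated set of characters relative to a measure. -/
def Dissoc (ν0 : G → ℝ) (Λ : Finset (AddChar G ℂ)) : Prop :=
  ∀ m : AddChar G ℂ → SignType, (∃ l ∈ Λ, m l ≠ 0) →
    ‖∑ y, (ν0 y : ℂ) * (∏ l ∈ Λ, l ^ (m l : ℤ)) y‖ ≤ 1 / 2

lemma dissoc_card {ν0 ν : G → ℝ} (hν : IsProb ν) {M : ℕ}
    (hpow : ∀ χ : AddChar G ℂ, ∑ y, (ν y : ℂ) * χ y = (∑ y, (ν0 y : ℂ) * χ y) ^ M)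
    {p ε : ℝ} (hp : 2 ≤ p) (hε : 0 < ε) {H : G → ℂ}
    (hH : ∀ F : G → ℂ, ‖∑ y, (ν y : ℂ) * H y * F y‖ ≤ LpW p ν F)
    {Λ : Finset (AddChar G ℂ)} (hΛ : Dissoc ν0 Λ)
    (hM : Real.exp (√(p * Λ.card)) ≤ 2 ^ M)
    (hspec : ∀ l ∈ Λ, ε ≤ ‖∑ y, (ν y : ℂ) * H y * l y‖) :
    (Λ.card : ℝ) ≤ 100 * p / ε ^ 2 := by
  classical
  rcases Nat.eq_zero_or_pos Λ.card with h0 | hpos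
  · rw [h0]; push_cast; positivity
  set T : AddChar G ℂ → ℂ := fun l => ∑ y, (ν y : ℂ) * H y * l y with hT
  set c : Λ → ℂ := fun l => (starRingEnd ℂ) (T l.1) / (‖T l.1‖ : ℂ) with hc
  have hcard : Fintype.card Λ = Λ.card := Fintype.card_coe Λ
  have hTpos : ∀ l : Λ, 0 < ‖T l.1‖ := fun l => hε.trans_le (hspec l.1 l.2)
  have hc1 : ∀ l, ‖c l‖ ≤ 1 := by
    intro l
    simp only [hc, norm_div, RCLike.norm_conj, Complex.norm_real, norm_norm]
    rw [div_self (hTpos l).ne']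
  have hR := rudin_Lp (fun l : Λ => l.1) c hc1 hν hp (τ := (1 / 2) ^ M) (by positivity)
    (by rw [hcard]; exact hpos) (by
      intro m hm
      set m' : AddChar G ℂ → SignType := fun l => if h : l ∈ Λ then m ⟨l, h⟩ else 0 with hm'
      have h1 : ∃ l ∈ Λ, m' l ≠ 0 := by
        obtain ⟨l, hl⟩ := Function.ne_iff.1 hm
        exact ⟨l.1, l.2, by simpa [hm'] using hl⟩
      have h2 : ∀ y, (∏ l ∈ Λ, l ^ (m' l : ℤ)) y = ∏ i : Λ, (i.1 y) ^ (m i : ℤ) := by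
        intro y
        rw [AddChar.prod_apply, ← Finset.prod_coe_sort]
        refine Finset.prod_congr rfl fun i _ => ?_
        rw [AddChar.zpow_apply]
        simp [hm']
      have h3 := hΛ m' h1
      have h4 := hpow (∏ l ∈ Λ, l ^ (m' l : ℤ))
      simp only [h2] at h3 h4
      rw [h4, norm_pow]
      exact pow_le_pow_left₀ (norm_nonneg _) h3 M) (by
      rw [hcard]
      calc (1 / 2 : ℝ) ^ M * Real.exp (√(p * Λ.card)) ≤ (1 / 2 : ℝ) ^ M * 2 ^ M := by gcongr
        _ = 1 := by rw [← mul_pow]; norm_num)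
  have hlow : (Λ.card : ℝ) * ε ≤ ‖∑ y, (ν y : ℂ) * H y * ∑ i : Λ, c i * i.1 y‖ := by
    have e : ∑ y, (ν y : ℂ) * H y * ∑ i : Λ, c i * i.1 y = ((∑ i : Λ, ‖T i.1‖ : ℝ) : ℂ) := by
      simp only [Finset.mul_sum]
      rw [Finset.sum_comm, Complex.ofReal_sum]
      refine Finset.sum_congr rfl fun i _ => ?_
      have : ∑ y, (ν y : ℂ) * H y * (c i * i.1 y) = c i * T i.1 := by
        rw [hT, Finset.mul_sum]
        exact Finset.sum_congr rfl fun y _ => by ring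
      rw [this, hc]
      have hne : (‖T i.1‖ : ℂ) ≠ 0 := by exact_mod_cast (hTpos i).ne'
      have h1 : (starRingEnd ℂ) (T i.1) * T i.1 = (‖T i.1‖ : ℂ) ^ 2 := by
        rw [mul_comm, Complex.mul_conj, Complex.normSq_eq_norm_sq]; push_cast; rfl
      simp only
      rw [div_mul_eq_mul_div, h1]
      field_simp
    rw [e, Complex.norm_real]
    refine le_trans ?_ (le_abs_self _)
    calc (Λ.card : ℝ) * ε = ∑ i : Λ, ε := by simp
      _ ≤ _ := Finset.sum_le_sum fun i _ => hspec i.1 i.2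
  have hfin := hlow.trans ((hH _).trans hR)
  rw [hcard] at hfin
  have hk0 : (0 : ℝ) < Λ.card := by exact_mod_cast hpos
  have hsq : ((Λ.card : ℝ) * ε) ^ 2 ≤ (10 * √(p * Λ.card)) ^ 2 :=
    pow_le_pow_left₀ (by positivity) hfin 2
  rw [mul_pow, mul_pow, Real.sq_sqrt (by positivity)] at hsq
  rw [le_div_iff₀ (by positivity)]
  have : (Λ.card : ℝ) * (Λ.card * ε ^ 2) ≤ Λ.card * (100 * p) := by nlinarith
  exact le_of_mul_le_mul_left this hk0

lemma norm_one_sub_mul {a b : ℂ} (ha : ‖a‖ = 1) : ‖1 - a * b‖ ≤ ‖1 - a‖ + ‖1 - b‖ := by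
  calc ‖1 - a * b‖ = ‖(1 - a) + a * (1 - b)‖ := by ring_nf
    _ ≤ _ := norm_add_le _ _
    _ = _ := by rw [norm_mul, ha, one_mul]

lemma norm_one_sub_inv {a : ℂ} (ha : ‖a‖ = 1) : ‖1 - a⁻¹‖ = ‖1 - a‖ := by
  have h0 : a ≠ 0 := by intro h; simp [h] at ha
  have : 1 - a⁻¹ = -(a⁻¹ * (1 - a)) := by field_simp; ring
  rw [this, norm_neg, norm_mul, norm_inv, ha]; simp

lemma norm_one_sub_sign {a : ℂ} (ha : ‖a‖ = 1) {s : SignType} (hs : s ≠ 0) :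
    ‖1 - a ^ (s : ℤ)‖ = ‖1 - a‖ := by
  cases s with
  | zero => exact absurd rfl hs
  | neg => simpa using norm_one_sub_inv ha
  | pos => simp

lemma norm_one_sub_sign_le {a : ℂ} (ha : ‖a‖ = 1) (s : SignType) :
    ‖1 - a ^ (s : ℤ)‖ ≤ ‖1 - a‖ := by
  by_cases hs : s = 0
  · subst hs; simp
  · exact (norm_one_sub_sign ha hs).le

lemma norm_one_sub_prod (Λ : Finset (AddChar G ℂ)) (m : AddChar G ℂ → SignType) (x : G) :
    ‖1 - (∏ l ∈ Λ, l ^ (m l : ℤ)) x‖ ≤ ∑ l ∈ Λ, ‖1 - l x‖ := by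
  classical
  induction Λ using Finset.induction_on with
  | empty => simp
  | insert a s ha ih =>
    rw [Finset.prod_insert ha, Finset.sum_insert ha, AddChar.mul_apply]
    refine (norm_one_sub_mul (char_norm _ _)).trans (add_le_add ?_ ih)
    rw [AddChar.zpow_apply]
    exact norm_one_sub_sign_le (char_norm _ _) _

lemma chang {ν0 ν : G → ℝ} (hν0 : IsProb ν0) (hν : IsProb ν) {M : ℕ}
    (hpow : ∀ χ : AddChar G ℂ, ∑ y, (ν y : ℂ) * χ y = (∑ y, (ν0 y : ℂ) * χ y) ^ M)
    {p ε : ℝ} (hp : 2 ≤ p) (hε : 0 < ε) {H : G → ℂ}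
    (hH : ∀ F : G → ℂ, ‖∑ y, (ν y : ℂ) * H y * F y‖ ≤ LpW p ν F)
    (hM : ∀ k : ℕ, (k : ℝ) ≤ 100 * p / ε ^ 2 + 1 → Real.exp (√(p * k)) ≤ 2 ^ M) :
    ∃ Λ : Finset (AddChar G ℂ), (Λ.card : ℝ) ≤ 100 * p / ε ^ 2 ∧
      ∀ γ : AddChar G ℂ, ε ≤ ‖∑ y, (ν y : ℂ) * H y * γ y‖ →
        ∃ χ : AddChar G ℂ, 1 / 2 < ‖∑ y, (ν0 y : ℂ) * χ y‖ ∧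
          ∀ x, ‖1 - γ x‖ ≤ ‖1 - χ x‖ + ∑ l ∈ Λ, ‖1 - l x‖ := by
  classical
  set Sp : Finset (AddChar G ℂ) := Finset.univ.filter fun γ => ε ≤ ‖∑ y, (ν y : ℂ) * H y * γ y‖
  set fam : Finset (Finset (AddChar G ℂ)) := Sp.powerset.filter fun Λ =>
    Dissoc ν0 Λ ∧ (Λ.card : ℝ) ≤ 100 * p / ε ^ 2 with hfam
  have hne : fam.Nonempty := by
    refine ⟨∅, ?_⟩
    simp only [hfam, Finset.mem_filter, Finset.mem_powerset, Finset.empty_subset, true_and]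
    refine ⟨?_, by simp; positivity⟩
    rintro m ⟨l, hl, _⟩
    simp at hl
  obtain ⟨Λ, hΛmem, hmax⟩ := Finset.exists_max_image fam Finset.card hne
  simp only [hfam, Finset.mem_filter, Finset.mem_powerset] at hΛmem
  obtain ⟨hsub, hdis, hcard⟩ := hΛmem
  refine ⟨Λ, hcard, fun γ hγ => ?_⟩
  by_cases hmem : γ ∈ Λ
  · refine ⟨1, ?_, fun x => ?_⟩
    · simp only [AddChar.one_apply, mul_one]
      rw [← Complex.ofReal_sum, hν0.2]; norm_num
    · simp only [AddChar.one_apply, sub_self, norm_zero, zero_add]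
      exact Finset.single_le_sum (f := fun l : AddChar G ℂ => ‖1 - l x‖)
        (fun l _ => norm_nonneg _) hmem
  have hnot : ¬ Dissoc ν0 (insert γ Λ) := by
    intro hd
    have hsub' : insert γ Λ ⊆ Sp := by
      refine Finset.insert_subset ?_ hsub
      simp only [Sp, Finset.mem_filter, Finset.mem_univ, true_and]; exact hγ
    have hc' : ((insert γ Λ).card : ℝ) ≤ 100 * p / ε ^ 2 := by
      refine dissoc_card hν hpow hp hε hH hd (hM _ ?_) ?_
      · rw [Finset.card_insert_of_notMem hmem]; push_cast; linarith
      · intro l hl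
        have := hsub' hl
        simp only [Sp, Finset.mem_filter, Finset.mem_univ, true_and] at this
        exact this
    have := hmax (insert γ Λ) (by
      simp only [hfam, Finset.mem_filter, Finset.mem_powerset]
      exact ⟨hsub', hd, hc'⟩)
    rw [Finset.card_insert_of_notMem hmem] at this
    omega
  unfold Dissoc at hnot
  push Not at hnot
  obtain ⟨m, ⟨l, hl, hml⟩, hbig⟩ := hnot
  have hmγ : m γ ≠ 0 := by
    intro h0
    rw [Finset.prod_insert hmem, h0] at hbig
    simp only [SignType.coe_zero, zpow_zero, one_mul] at hbig
    refine absurd (hdis m ⟨l, ?_, hml⟩) (not_le.2 hbig)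
    rcases Finset.mem_insert.1 hl with rfl | h
    · exact absurd h0 hml
    · exact h
  refine ⟨_, hbig, fun x => ?_⟩
  set P : AddChar G ℂ := ∏ l ∈ Λ, l ^ (m l : ℤ) with hP
  rw [Finset.prod_insert hmem, ← hP]
  rw [← norm_one_sub_sign (char_norm γ x) hmγ]
  have hPx : P x ≠ 0 := by
    intro h; have := char_norm P x; rw [h] at this; simp at this
  have e : (γ x) ^ (m γ : ℤ) = (γ ^ (m γ : ℤ) * P) x * (P x)⁻¹ := by
    rw [AddChar.mul_apply, AddChar.zpow_apply]; field_simp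
  rw [e]
  refine (norm_one_sub_mul (char_norm _ _)).trans ?_
  rw [norm_one_sub_inv (char_norm _ _)]
  exact add_le_add le_rfl (norm_one_sub_prod Λ m x)

end chang

section fourier
variable {G : Type} [AddCommGroup G] [Fintype G]

lemma char_conj (γ : AddChar G ℂ) (x : G) : (starRingEnd ℂ) (γ x) = γ (-x) := by
  rw [AddChar.map_neg_eq_inv, Complex.inv_def, Complex.normSq_eq_norm_sq, char_norm]; simp

lemma fourier_inversion (f : G → ℂ) (x : G) :
    f x = ∑ γ : AddChar G ℂ, fourierCoeff f γ * γ x := by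
  classical
  unfold fourierCoeff
  have hc : (Fintype.card G : ℂ) ≠ 0 := by exact_mod_cast Fintype.card_ne_zero
  have e : ∀ γ : AddChar G ℂ, (Fintype.card G : ℂ)⁻¹ * (∑ z, f z * (starRingEnd ℂ) (γ z)) * γ x =
      ∑ z, (Fintype.card G : ℂ)⁻¹ * f z * γ (x - z) := by
    intro γ
    rw [Finset.mul_sum, Finset.sum_mul]
    refine Finset.sum_congr rfl fun z _ => ?_
    rw [char_conj, sub_eq_add_neg, AddChar.map_add_eq_mul]; ring
  simp only [e]
  rw [Finset.sum_comm]
  simp only [← Finset.mul_sum, AddChar.sum_apply_eq_ite, sub_eq_zero]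
  rw [Finset.sum_eq_single x]
  · simp; field_simp
  · intro z _ hz; rw [if_neg (Ne.symm hz)]; simp
  · simp

lemma diff_fourier (f : G → ℂ) {μ : G → ℝ} (y : G) :
    f y - convC f μ y = ∑ γ : AddChar G ℂ, fourierCoeff f γ * (1 - ∑ z, (μ z : ℂ) * γ (-z)) * γ y := by
  have e : convC f μ y = ∑ γ : AddChar G ℂ, fourierCoeff f γ * (∑ z, (μ z : ℂ) * γ (-z)) * γ y := by
    unfold convC
    simp only [fourier_inversion f (y - _), Finset.sum_mul, Finset.mul_sum]
    rw [Finset.sum_comm]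
    refine Finset.sum_congr rfl fun γ _ => Finset.sum_congr rfl fun z _ => ?_
    rw [sub_eq_add_neg, AddChar.map_add_eq_mul]; ring
  rw [e, fourier_inversion f y, ← Finset.sum_sub_distrib]
  exact Finset.sum_congr rfl fun γ _ => by ring

lemma norm_one_sub_hat {μ : G → ℝ} (hμ : IsProb μ) (γ : AddChar G ℂ) {e : ℝ}
    (h : ∀ z, μ z ≠ 0 → ‖1 - γ z‖ ≤ e) : ‖1 - ∑ z, (μ z : ℂ) * γ (-z)‖ ≤ e := by
  have e1 : 1 - ∑ z, (μ z : ℂ) * γ (-z) = ∑ z, (μ z : ℂ) * (1 - γ (-z)) := by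
    simp only [mul_sub, mul_one, Finset.sum_sub_distrib]
    rw [← Complex.ofReal_sum, hμ.2]; simp
  rw [e1]
  refine (norm_sum_le _ _).trans ?_
  calc ∑ z, ‖(μ z : ℂ) * (1 - γ (-z))‖ ≤ ∑ z, μ z * e := by
        refine Finset.sum_le_sum fun z _ => ?_
        rw [norm_mul, Complex.norm_real, Real.norm_of_nonneg (hμ.1 z), AddChar.map_neg_eq_inv,
          norm_one_sub_inv (char_norm _ _)]
        by_cases hz : μ z = 0
        · simp [hz]
        · exact mul_le_mul_of_nonneg_left (h z hz) (hμ.1 z)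
    _ = e := by rw [← Finset.sum_mul, hμ.2, one_mul]

lemma LpW_char {ν : G → ℝ} (hν : IsProb ν) {p : ℝ} (γ : AddChar G ℂ) : LpW p ν γ = 1 := by
  unfold LpW
  simp [char_norm, hν.2]

lemma wiener_eq (f : G → ℂ) : wienerNorm f = ∑ γ : AddChar G ℂ, ‖fourierCoeff f γ‖ :=
  finsum_eq_sum_of_fintype _

lemma dual_fourier {f : G → ℂ} {μ ν : G → ℝ} (hν : IsProb ν) {p : ℝ} (hp : 2 ≤ p) (x : G) :
    ∃ H : G → ℂ, (∀ F : G → ℂ, ‖∑ y, (ν y : ℂ) * H y * F y‖ ≤ LpW p ν F) ∧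
      LpW p (fun y => ν (y - x)) (fun y => f y - convC f μ y) ≤
        ∑ γ : AddChar G ℂ, ‖fourierCoeff f γ‖ * ‖1 - ∑ z, (μ z : ℂ) * γ (-z)‖ *
          ‖∑ y, (ν y : ℂ) * H y * γ y‖ := by
  have e1 : LpW p (fun y => ν (y - x)) (fun y => f y - convC f μ y) =
      LpW p ν (fun y => f (y + x) - convC f μ (y + x)) := by
    unfold LpW
    rw [← Equiv.sum_comp (Equiv.addRight x)]
    simp
  obtain ⟨H, h1, h2⟩ := dual hp hν.1 (fun y => f (y + x) - convC f μ (y + x))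
  refine ⟨H, h2, ?_⟩
  rw [e1]
  have e2 : LpW p ν (fun y => f (y + x) - convC f μ (y + x)) =
      ‖((LpW p ν (fun y => f (y + x) - convC f μ (y + x)) : ℝ) : ℂ)‖ := by
    rw [Complex.norm_real, Real.norm_of_nonneg (LpW_nonneg hν.1 _)]
  rw [e2, ← h1]
  have e3 : ∑ y, (ν y : ℂ) * H y * (f (y + x) - convC f μ (y + x)) =
      ∑ γ : AddChar G ℂ, fourierCoeff f γ * (1 - ∑ z, (μ z : ℂ) * γ (-z)) * γ x *
        ∑ y, (ν y : ℂ) * H y * γ y := by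
    simp only [diff_fourier]
    calc ∑ y, (ν y : ℂ) * H y * ∑ γ : AddChar G ℂ,
          fourierCoeff f γ * (1 - ∑ z, (μ z : ℂ) * γ (-z)) * γ (y + x)
        = ∑ y, ∑ γ : AddChar G ℂ, fourierCoeff f γ * (1 - ∑ z, (μ z : ℂ) * γ (-z)) * γ x *
          ((ν y : ℂ) * H y * γ y) := by
          refine Finset.sum_congr rfl fun y _ => ?_
          rw [Finset.mul_sum]
          refine Finset.sum_congr rfl fun γ _ => ?_
          rw [AddChar.map_add_eq_mul]; ring
      _ = _ := by
          rw [Finset.sum_comm]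
          refine Finset.sum_congr rfl fun γ _ => ?_
          rw [Finset.mul_sum]
  rw [e3]
  refine (norm_sum_le _ _).trans (le_of_eq ?_)
  refine Finset.sum_congr rfl fun γ _ => ?_
  rw [norm_mul, norm_mul, norm_mul, char_norm, mul_one]

end fourier

section pigeon

lemma dyadic {t : ℝ} (h1 : t ≤ 1) (J : ℕ) :
    t ≤ (1 / 2) ^ J + ∑ j ∈ Finset.range (J + 1), if (1 / 2 : ℝ) ^ j ≤ t then (1 / 2 : ℝ) ^ j else 0 := by
  induction J with
  | zero =>
    have : (0 : ℝ) ≤ ∑ j ∈ Finset.range 1, if (1 / 2 : ℝ) ^ j ≤ t then (1 / 2 : ℝ) ^ j else 0 :=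
      Finset.sum_nonneg fun j _ => by split_ifs <;> positivity
    simp only [pow_zero]; linarith
  | succ J ih =>
    rw [Finset.sum_range_succ]
    have : (0 : ℝ) ≤ ∑ j ∈ Finset.range (J + 1), if (1 / 2 : ℝ) ^ j ≤ t then (1 / 2 : ℝ) ^ j else 0 :=
      Finset.sum_nonneg fun j _ => by split_ifs <;> positivity
    split_ifs with h
    · have : (1 / 2 : ℝ) ^ (J + 1) + (1 / 2 : ℝ) ^ (J + 1) = (1 / 2) ^ J := by rw [pow_succ]; ring
      linarith
    · push Not at h
      linarith

lemma pigeon {ι : Type*} (T : Finset ι) (a θ : ι → ℝ) (ha : ∀ i, 0 ≤ a i) (hθ1 : ∀ i, θ i ≤ 1)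
    {E : ℝ} (hE : 0 < E) (J : ℕ) (hbig : E / 4 ≤ ∑ i ∈ T, a i * θ i - (1 / 2) ^ J * ∑ i ∈ T, a i) :
    ∃ j ≤ J, E / 32 ≤ ∑ i ∈ T.filter (fun i => (1 / 2 : ℝ) ^ j ≤ θ i), a i ∧
      2 ^ j * E ≤ 16 * (J + 1) * ∑ i ∈ T.filter (fun i => (1 / 2 : ℝ) ^ j ≤ θ i), a i := by
  classical
  by_contra hcon
  push Not at hcon
  set m : ℕ → ℝ := fun j => ∑ i ∈ T.filter (fun i => (1 / 2 : ℝ) ^ j ≤ θ i), a i with hm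
  have h1 : ∑ i ∈ T, a i * θ i ≤ (1 / 2) ^ J * ∑ i ∈ T, a i +
      ∑ j ∈ Finset.range (J + 1), (1 / 2 : ℝ) ^ j * m j := by
    calc ∑ i ∈ T, a i * θ i ≤ ∑ i ∈ T, a i * ((1 / 2) ^ J +
          ∑ j ∈ Finset.range (J + 1), if (1 / 2 : ℝ) ^ j ≤ θ i then (1 / 2 : ℝ) ^ j else 0) :=
          Finset.sum_le_sum fun i _ => mul_le_mul_of_nonneg_left (dyadic (hθ1 i) J) (ha i)
      _ = _ := by
          simp only [mul_add, Finset.sum_add_distrib, Finset.mul_sum]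
          congr 1
          · exact Finset.sum_congr rfl fun i _ => mul_comm _ _
          · rw [Finset.sum_comm]
            refine Finset.sum_congr rfl fun j _ => ?_
            simp only [hm]
            rw [Finset.mul_sum, Finset.sum_filter]
            refine Finset.sum_congr rfl fun i _ => ?_
            split_ifs <;> ring
  have h2 : ∀ j ∈ Finset.range (J + 1), (1 / 2 : ℝ) ^ j * m j ≤
      (1 / 2 : ℝ) ^ j * (E / 32) + E / (16 * (J + 1)) := by
    intro j hj
    have hj' : j ≤ J := by have := Finset.mem_range.1 hj; omega
    have hpj : (0 : ℝ) < (1 / 2) ^ j := by positivity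
    have hJ : (0 : ℝ) < 16 * (J + 1) := by positivity
    by_cases h : E / 32 ≤ m j
    · have h3 := hcon j hj' h
      have h4 : (1 / 2 : ℝ) ^ j * m j ≤ E / (16 * (J + 1)) := by
        rw [le_div_iff₀ hJ]
        have h5 : (1 / 2 : ℝ) ^ j * 2 ^ j = 1 := by rw [← mul_pow]; norm_num
        calc (1 / 2 : ℝ) ^ j * m j * (16 * (J + 1)) = (1 / 2 : ℝ) ^ j * (16 * (J + 1) * m j) := by ring
          _ ≤ (1 / 2 : ℝ) ^ j * (2 ^ j * E) := mul_le_mul_of_nonneg_left h3.le hpj.le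
          _ = E := by rw [← mul_assoc, h5, one_mul]
      have : 0 ≤ (1 / 2 : ℝ) ^ j * (E / 32) := by positivity
      linarith
    · push Not at h
      have : (1 / 2 : ℝ) ^ j * m j ≤ (1 / 2 : ℝ) ^ j * (E / 32) :=
        mul_le_mul_of_nonneg_left h.le hpj.le
      have : 0 ≤ E / (16 * (J + 1)) := by positivity
      linarith
  have h3 := Finset.sum_le_sum h2
  rw [Finset.sum_add_distrib, ← Finset.sum_mul, Finset.sum_const, Finset.card_range, nsmul_eq_mul] at h3
  have h4 : ∑ j ∈ Finset.range (J + 1), (1 / 2 : ℝ) ^ j ≤ 2 := sum_geometric_two_le _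
  have h5 : ((J + 1 : ℕ) : ℝ) * (E / (16 * (J + 1))) = E / 16 := by push_cast; field_simp
  have h6 : (∑ j ∈ Finset.range (J + 1), (1 / 2 : ℝ) ^ j) * (E / 32) ≤ 2 * (E / 32) := by gcongr
  linarith

end pigeon

section step
variable {G : Type} [AddCommGroup G] [Fintype G]

lemma ApproxInvariant.mono {F F' : ℝ → Set G} {w : G → ℝ} (h : ApproxInvariant F w)
    (hF : ∀ η, 0 < η → η ≤ 1 → F' η ⊆ F η) : ApproxInvariant F' w := by
  intro η h0 h1
  obtain ⟨wp, wm, hp, hm, hh⟩ := h η h0 h1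
  exact ⟨wp, wm, hp, hm, fun x hx => hh x (hF η h0 h1 hx)⟩

lemma DimLE.mono {ρ : G → ℝ} {D D' : ℝ} (h : DimLE ρ D) (hD : D ≤ D') : DimLE ρ D' := by
  intro η h0 h1
  obtain ⟨n, hn, hc⟩ := h η h0 h1
  exact ⟨n, hn.trans (Real.rpow_le_rpow_of_exponent_le (by norm_num) hD), hc⟩

lemma step {ρ : G → ℝ} (h : IsBN ρ) {D : ℝ} (hD : 1 ≤ D) (hd : DimLE ρ D)
    (f : G → ℂ) {δ κ p : ℝ} (hδ : 0 < δ) (hδ1 : δ ≤ 1) (hκ : 0 < κ) (hκ1 : κ ≤ 1) (hp : 2 ≤ p)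
    (hf : 0 < wienerNorm f)
    {M J : ℕ} (hM1 : 1 ≤ M) (hJ : (1 / 2 : ℝ) ^ J ≤ δ / 8)
    (hM : ∀ k : ℕ, (k : ℝ) ≤ 100 * p * 4 ^ J + 1 → Real.exp (√(p * k)) ≤ 2 ^ M)
    {S : Finset (AddChar G ℂ)} (hS : ∀ γ ∈ S, ∀ x, ρ x < 1 → ‖1 - γ x‖ ≤ δ / 4) :
    (∃ μ ν : G → ℝ, IsProb μ ∧ ApproxInvariant (fun η => {x | ρ x < η / (80 * D)}) μ ∧ IsProb ν ∧
        (∀ y, ν y ≠ 0 → ρ y < κ / (80 * D)) ∧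
        ∀ x, LpW p (fun y => ν (y - x)) (fun y => f y - convC f μ y) ≤ δ * wienerNorm f) ∨
    (∃ (j : ℕ) (W Λ : Finset (AddChar G ℂ)), j ≤ J ∧ Disjoint S W ∧
      δ * wienerNorm f / 32 ≤ ∑ γ ∈ W, ‖fourierCoeff f γ‖ ∧
      2 ^ j * (δ * wienerNorm f) ≤ 16 * (J + 1) * ∑ γ ∈ W, ‖fourierCoeff f γ‖ ∧
      (Λ.card : ℝ) ≤ 100 * p * 4 ^ j ∧
      ∀ γ ∈ W, ∀ x, ρ x < δ * κ / (409600 * M * D ^ 2) →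
        ‖1 - γ x‖ ≤ δ / 8 + ∑ l ∈ Λ, ‖1 - l x‖) := by
  classical
  have hD0 : 0 < D := by linarith
  have hM0 : (0 : ℝ) < M := by exact_mod_cast hM1
  have hM1' : (1 : ℝ) ≤ M := by exact_mod_cast hM1
  obtain ⟨μ, hμ, hμs, hμi⟩ := invMeasure h hD hd
  set l : ℝ := κ / (160 * M * D) with hl
  have hl0 : 0 < l := by positivity
  have hl1 : l ≤ 1 := by
    rw [hl, div_le_one (by positivity)]
    nlinarith
  obtain ⟨ν0, hν0, hν0s, hν0i⟩ := invMeasure (h.scale hl0) hD (hd.scale hl0 hl1)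
  obtain ⟨ν, hν, hνs, hpow⟩ := exists_power h hν0 (r := l) (fun y hy => by
    have := hν0s y hy
    rw [div_lt_one hl0] at this
    exact this.le) M
  have hνs' : ∀ y, ν y ≠ 0 → ρ y < κ / (80 * D) := by
    intro y hy
    refine (hνs y hy).trans_lt ?_
    rw [hl, ← mul_div_assoc, div_lt_div_iff₀ (by positivity) (by positivity)]
    nlinarith [mul_pos (mul_pos hM0 hκ) hD0]
  by_cases hall : ∀ x, LpW p (fun y => ν (y - x)) (fun y => f y - convC f μ y) ≤ δ * wienerNorm f
  · exact Or.inl ⟨μ, ν, hμ, hμi, hν, hνs', hall⟩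
  right
  push Not at hall
  obtain ⟨x0, hx0⟩ := hall
  obtain ⟨H, hH, hle⟩ := dual_fourier (f := f) (μ := μ) hν hp x0
  set θ : AddChar G ℂ → ℝ := fun γ => ‖∑ y, (ν y : ℂ) * H y * γ y‖ with hθ
  have hθ1 : ∀ γ, θ γ ≤ 1 := fun γ => (hH γ).trans (LpW_char hν γ).le
  have hθ0 : ∀ γ, 0 ≤ θ γ := fun γ => norm_nonneg _
  set a : AddChar G ℂ → ℝ := fun γ => ‖fourierCoeff f γ‖ with ha
  have ha0 : ∀ γ, 0 ≤ a γ := fun γ => norm_nonneg _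
  set Fn := wienerNorm f with hFn
  have hFsum : Fn = ∑ γ, a γ := wiener_eq f
  have hsplit : ∀ g : AddChar G ℂ → ℝ, ∑ γ, g γ = ∑ γ ∈ S, g γ + ∑ γ ∈ Sᶜ, g γ := fun g =>
    (Finset.sum_add_sum_compl S g).symm
  have hSc : ∑ γ ∈ Sᶜ, a γ ≤ Fn := by
    rw [hFsum, hsplit]
    have : 0 ≤ ∑ γ ∈ S, a γ := Finset.sum_nonneg fun γ _ => ha0 γ
    linarith
  have hSs : ∑ γ ∈ S, a γ ≤ Fn := by
    rw [hFsum, hsplit]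
    have : 0 ≤ ∑ γ ∈ Sᶜ, a γ := Finset.sum_nonneg fun γ _ => ha0 γ
    linarith
  have h1 := hx0.trans_le hle
  rw [hsplit] at h1
  have h2 : ∑ γ ∈ S, ‖fourierCoeff f γ‖ * ‖1 - ∑ z, (μ z : ℂ) * γ (-z)‖ *
          ‖∑ y, (ν y : ℂ) * H y * γ y‖ ≤ δ / 4 * Fn := by
    calc _ ≤ ∑ γ ∈ S, δ / 4 * a γ := by
          refine Finset.sum_le_sum fun γ hγ => ?_
          have e1 := norm_one_sub_hat hμ γ (e := δ / 4) fun z hz => hS γ hγ z (hμs z hz)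
          calc _ ≤ a γ * (δ / 4) * 1 := by
                refine mul_le_mul (mul_le_mul_of_nonneg_left e1 (ha0 γ)) (hθ1 γ) (norm_nonneg _)
                  (mul_nonneg (ha0 γ) (by positivity))
            _ = _ := by ring
      _ = δ / 4 * ∑ γ ∈ S, a γ := by rw [Finset.mul_sum]
      _ ≤ _ := by gcongr
  have h3 : ∑ γ ∈ Sᶜ, ‖fourierCoeff f γ‖ * ‖1 - ∑ z, (μ z : ℂ) * γ (-z)‖ *
          ‖∑ y, (ν y : ℂ) * H y * γ y‖ ≤ 2 * ∑ γ ∈ Sᶜ, a γ * θ γ := by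
    rw [Finset.mul_sum]
    refine Finset.sum_le_sum fun γ _ => ?_
    have e1 := norm_one_sub_hat hμ γ (e := 2) fun z _ => by
      refine (norm_sub_le _ _).trans ?_
      rw [char_norm]; norm_num
    calc _ ≤ a γ * 2 * θ γ := by
          refine mul_le_mul_of_nonneg_right (mul_le_mul_of_nonneg_left e1 (ha0 γ)) (hθ0 γ)
      _ = _ := by ring
  have h4 : (1 / 2 : ℝ) ^ J * ∑ γ ∈ Sᶜ, a γ ≤ δ / 8 * Fn := by
    have : 0 ≤ ∑ γ ∈ Sᶜ, a γ := Finset.sum_nonneg fun γ _ => ha0 γ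
    gcongr
  obtain ⟨j, hjJ, hm1, hm2⟩ := pigeon Sᶜ a θ ha0 hθ1 (E := δ * Fn) (by positivity) J (by linarith)
  have h4j : (100 : ℝ) * p / ((1 / 2 : ℝ) ^ j) ^ 2 = 100 * p * 4 ^ j := by
    rw [← pow_mul, mul_comm j 2, pow_mul, div_eq_mul_inv, ← inv_pow]; norm_num
  obtain ⟨Λ, hΛc, hΛ⟩ := chang hν0 hν hpow hp (ε := (1 / 2 : ℝ) ^ j) (by positivity) hH (by
    intro k hk
    refine hM k (hk.trans ?_)
    rw [h4j]
    have : (4 : ℝ) ^ j ≤ 4 ^ J := pow_le_pow_right₀ (by norm_num) hjJ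
    gcongr)
  refine ⟨j, Sᶜ.filter (fun γ => (1 / 2 : ℝ) ^ j ≤ θ γ), Λ, hjJ, ?_, hm1, hm2, by rw [← h4j]; exact hΛc, ?_⟩
  · rw [Finset.disjoint_left]
    intro γ h1 h2
    exact (Finset.mem_compl.1 (Finset.mem_filter.1 h2).1) h1
  · intro γ hγ x hx
    obtain ⟨χ, hχ, hbd⟩ := hΛ γ (Finset.mem_filter.1 hγ).2
    refine (hbd x).trans (add_le_add ?_ le_rfl)
    have h80 : (0 : ℝ) < δ / 32 / (80 * D) := by positivity
    have := approxInv_char hν0i (η := δ / 32) (by positivity) (by linarith)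
      (by simpa [h.zero] using h80) (x := x) (by
        change ρ x / l < δ / 32 / (80 * D)
        rw [div_lt_iff₀ hl0]
        refine hx.trans_le (le_of_eq ?_)
        rw [hl]; field_simp; norm_num) χ
    nlinarith [norm_nonneg (1 - χ x)]

end step

section iterate
variable {G : Type} [AddCommGroup G] [Fintype G]

/-- The invariant maintained by the iteration. -/
def GoodState (ρ0 : G → ℝ) (A : Set G) (d δ a Q N0 : ℝ) (S : Finset (AddChar G ℂ)) (r : ℝ) : Prop :=
  ∃ ρ : G → ℝ, IsBN ρ ∧ (∀ x, ρ0 x ≤ ρ x) ∧ (∀ γ ∈ S, ∀ x, ρ x < 1 → ‖1 - γ x‖ ≤ δ / 4) ∧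
    DimLE ρ (d + a * r) ∧ ∃ n : ℕ, IsCov A {x | ρ x < 1} n ∧ (n : ℝ) ≤ Real.exp (Q * r) * N0

lemma increment {ρ ρ0 : G → ℝ} (h : IsBN ρ) (hρ0 : ∀ x, ρ0 x ≤ ρ x) {A : Set G}
    {d δ a Q N0 r r' D w l : ℝ} {q N : ℕ} (hδ : 0 < δ) (hN0 : 0 ≤ N0)
    {S W Λ : Finset (AddChar G ℂ)}
    (hS : ∀ γ ∈ S, ∀ x, ρ x < 1 → ‖1 - γ x‖ ≤ δ / 4)
    (hdim : DimLE ρ (d + a * r)) (hD : d + a * r ≤ D) {n : ℕ} (hcov : IsCov A {x | ρ x < 1} n)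
    (hn : (n : ℝ) ≤ Real.exp (Q * r) * N0)
    (hl : 0 < l) (hl1 : l ≤ 1) (hw : 0 < w) (hN : 2 ≤ N * w) (hN1 : 1 ≤ N)
    (hW : ∀ γ ∈ W, ∀ x, ρ x < l → ‖1 - γ x‖ ≤ δ / 8 + ∑ l ∈ Λ, ‖1 - l x‖)
    (hΛw : (Λ.card : ℝ) * (2 * π * w) ≤ δ / 8)
    (hq : (1 / 2 : ℝ) ^ (q + 1) ≤ l)
    (har : 2 * (Λ.card : ℝ) ≤ a * r')
    (hQ : D * (q + 1) * Real.log 2 + Λ.card * Real.log N ≤ Q * r') :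
    GoodState ρ0 A d δ a Q N0 (S ∪ W) (r + r') := by
  obtain ⟨ρ', h', hle, hcirc, hdim', hcov'⟩ := adjoin_family (h.scale hl) hw N hN A Λ
  have hle1 : ∀ x, ρ x ≤ ρ x / l := fun x => by
    rw [le_div_iff₀ hl]; nlinarith [h.nonneg x]
  have hle2 : ∀ x, ρ x ≤ ρ' x := fun x => (hle1 x).trans (hle x)
  refine ⟨ρ', h', fun x => (hρ0 x).trans (hle2 x), ?_, ?_, ?_⟩
  · intro γ hγ x hx
    rcases Finset.mem_union.1 hγ with h1 | h1
    · exact hS γ h1 x ((hle2 x).trans_lt hx)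
    · have hxl : ρ x < l := by
        have := (hle x).trans_lt hx
        rwa [div_lt_one hl] at this
      refine (hW γ h1 x hxl).trans ?_
      have : ∑ l ∈ Λ, ‖1 - l x‖ ≤ ∑ l ∈ Λ, 2 * π * w := by
        refine Finset.sum_le_sum fun l hl => (norm_one_sub_le (char_norm _ _)).trans ?_
        have := hcirc x hx l hl
        have := Real.pi_pos
        gcongr
      rw [Finset.sum_const, nsmul_eq_mul] at this
      linarith
  · intro η h0 h1
    obtain ⟨n1, hn1, hc1⟩ := (hdim.scale hl hl1) η h0 h1
    refine ⟨_, ?_, hdim' η h0 n1 hc1⟩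
    push_cast
    have e : (4 : ℝ) ^ Λ.card = 2 ^ (2 * (Λ.card : ℝ)) := by
      rw [show (4 : ℝ) = 2 ^ (2 : ℝ) by norm_num, ← Real.rpow_natCast, ← Real.rpow_mul (by norm_num)]
    calc (n1 : ℝ) * 4 ^ Λ.card ≤ 2 ^ (d + a * r) * 2 ^ (2 * (Λ.card : ℝ)) := by rw [e]; gcongr
      _ = 2 ^ (d + a * r + 2 * (Λ.card : ℝ)) := by rw [← Real.rpow_add (by norm_num)]
      _ ≤ _ := Real.rpow_le_rpow_of_exponent_le (by norm_num) (by linarith)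
  · obtain ⟨n1, hn1, hc1⟩ := (hdim.mono hD).iter q
    have hc2 : IsCov A {x | ρ x / l < 1} (n * n1) := by
      refine (hcov.trans hc1).mono subset_rfl ?_ le_rfl
      intro x hx
      change ρ x / l < 1
      rw [div_lt_one hl]
      exact lt_of_lt_of_le hx hq
    refine ⟨_, hcov' _ hc2, ?_⟩
    push_cast
    have hN0' : (0 : ℝ) < N := by exact_mod_cast hN1
    have e1 : ((2 : ℝ) ^ D) ^ (q + 1) = Real.exp (D * (q + 1) * Real.log 2) := by
      rw [Real.rpow_def_of_pos (by norm_num), ← Real.exp_nat_mul]; push_cast; ring_nf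
    have e2 : (N : ℝ) ^ Λ.card = Real.exp (Λ.card * Real.log N) := by
      rw [Real.exp_nat_mul, Real.exp_log hN0']
    calc (n : ℝ) * n1 * N ^ Λ.card
        ≤ (Real.exp (Q * r) * N0) * Real.exp (D * (q + 1) * Real.log 2) *
          Real.exp (Λ.card * Real.log N) := by
          rw [← e2]; rw [e1] at hn1; gcongr
      _ = Real.exp (Q * r + (D * (q + 1) * Real.log 2 + Λ.card * Real.log N)) * N0 := by
          rw [Real.exp_add, Real.exp_add]; ring
      _ ≤ _ := by
          refine mul_le_mul_of_nonneg_right (Real.exp_le_exp.2 ?_) hN0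
          linarith

set_option maxHeartbeats 1000000 in
lemma iterate {ρ0 : G → ℝ} (h0 : IsBN ρ0) {A : Set G} {d : ℝ} (hd : 1 ≤ d) (hdim : DimLE ρ0 d)
    {N0 : ℕ} (hN0 : IsCov A {x | ρ0 x < 1} N0)
    (f : G → ℂ) {δ κ p : ℝ} (hδ : 0 < δ) (hδ1 : δ ≤ 1) (hκ : 0 < κ) (hκ1 : κ ≤ 1) (hp : 2 ≤ p)
    (hf : 0 < wienerNorm f)
    {M J N q : ℕ} {a w Q D : ℝ} (hM1 : 1 ≤ M) (hJ : (1 / 2 : ℝ) ^ J ≤ δ / 8)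
    (hM : ∀ k : ℕ, (k : ℝ) ≤ 100 * p * 4 ^ J + 1 → Real.exp (√(p * k)) ≤ 2 ^ M)
    (ha : 51200 * p * (J + 1) ^ 2 / δ ^ 2 ≤ a) (hDa : D = d + a)
    (hw : 0 < w) (hN : 2 ≤ N * w) (hN1 : 1 ≤ N) (hwδ : 100 * p * 4 ^ J * (2 * π * w) ≤ δ / 8)
    (hq : (1 / 2 : ℝ) ^ (q + 1) ≤ δ * κ / (409600 * M * D ^ 2))
    (hQ : 32 / δ * (D * (q + 1) * Real.log 2) + a * Real.log N ≤ Q) :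
    ∃ ρ : G → ℝ, IsBN ρ ∧ (∀ x, ρ0 x ≤ ρ x) ∧ DimLE ρ D ∧
      (∃ n : ℕ, IsCov A {x | ρ x < 1} n ∧ (n : ℝ) ≤ Real.exp Q * N0) ∧
      ∃ μ ν : G → ℝ, IsProb μ ∧ ApproxInvariant (fun η => {x | ρ x < η / (80 * D)}) μ ∧ IsProb ν ∧
        (∀ y, ν y ≠ 0 → ρ y < κ / (80 * D)) ∧
        ∀ x, LpW p (fun y => ν (y - x)) (fun y => f y - convC f μ y) ≤ δ * wienerNorm f := by
  classical
  set Fn := wienerNorm f with hFn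
  set mass : Finset (AddChar G ℂ) → ℝ := fun S => ∑ γ ∈ S, ‖fourierCoeff f γ‖ with hmass
  have hmass0 : ∀ S, 0 ≤ mass S := fun S => Finset.sum_nonneg fun γ _ => norm_nonneg _
  have hmassF : ∀ S, mass S ≤ Fn := fun S => by
    rw [hFn, wiener_eq]
    exact Finset.sum_le_sum_of_subset_of_nonneg (Finset.subset_univ S) fun γ _ _ => norm_nonneg _
  have ha0 : 0 ≤ a := le_trans (by positivity) ha
  have hlogN : 0 ≤ Real.log N := Real.log_natCast_nonneg N
  have hlog2 : 0 < Real.log 2 := Real.log_pos (by norm_num)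
  have hD1 : 1 ≤ D := by linarith
  have hQ0 : 0 ≤ Q := le_trans (by positivity) hQ
  have hM0 : (1 : ℝ) ≤ M := by exact_mod_cast hM1
  set fam : Finset (Finset (AddChar G ℂ)) := Finset.univ.filter fun S =>
    GoodState ρ0 A d δ a Q N0 S (mass S / Fn) with hfam
  have hne : fam.Nonempty := by
    refine ⟨∅, ?_⟩
    simp only [hfam, Finset.mem_filter, Finset.mem_univ, true_and]
    refine ⟨ρ0, h0, fun _ => le_rfl, by simp, by simpa [hmass] using hdim, N0, hN0, by simp [hmass]⟩
  obtain ⟨S, hSm, hmax⟩ := Finset.exists_max_image fam mass hne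
  simp only [hfam, Finset.mem_filter, Finset.mem_univ, true_and] at hSm
  obtain ⟨ρ, h, hρ0, hS, hdρ, n, hcov, hn⟩ := hSm
  have hr1 : mass S / Fn ≤ 1 := (div_le_one hf).2 (hmassF S)
  have hr0 : 0 ≤ mass S / Fn := div_nonneg (hmass0 S) hf.le
  have hDle : d + a * (mass S / Fn) ≤ D := by rw [hDa]; nlinarith
  have hdD := hdρ.mono hDle
  rcases step h hD1 hdD f hδ hδ1 hκ hκ1 hp hf hM1 hJ hM hS with hgood | hinc
  · refine ⟨ρ, h, hρ0, hdD, ⟨n, hcov, hn.trans ?_⟩, hgood⟩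
    have : Q * (mass S / Fn) ≤ Q := by nlinarith
    gcongr
  · exfalso
    obtain ⟨j, W, Λ, hjJ, hdisj, hm1, hm2, hΛc, hWb⟩ := hinc
    have hm1' : δ * Fn / 32 ≤ mass W := hm1
    have hm2' : 2 ^ j * (δ * Fn) ≤ 16 * (J + 1) * mass W := hm2
    set r' := mass W / Fn with hr'
    have hr'1 : r' ≤ 1 := (div_le_one hf).2 (hmassF W)
    have hWF : mass W = r' * Fn := by rw [hr']; field_simp
    have hr'δ : δ / 32 ≤ r' := by
      rw [hWF] at hm1'
      have : (δ / 32) * Fn ≤ r' * Fn := by linarith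
      exact le_of_mul_le_mul_right this hf
    have hr'0 : 0 < r' := by linarith [hδ]
    have h2j : 2 ^ j * δ ≤ 16 * (J + 1) * r' := by
      rw [hWF] at hm2'
      have : (2 ^ j * δ) * Fn ≤ (16 * (J + 1) * r') * Fn := by linarith
      exact le_of_mul_le_mul_right this hf
    have h4j : (4 : ℝ) ^ j * δ ^ 2 ≤ 256 * (J + 1) ^ 2 * r' := by
      have h1 : (2 ^ j * δ) ^ 2 ≤ (16 * (J + 1) * r') ^ 2 := pow_le_pow_left₀ (by positivity) h2j 2
      have h2 : ((2 : ℝ) ^ j * δ) ^ 2 = 4 ^ j * δ ^ 2 := by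
        rw [mul_pow, ← pow_mul, mul_comm j 2, pow_mul]; norm_num
      rw [← h2]
      refine h1.trans ?_
      have h3 : r' ^ 2 ≤ r' := by nlinarith
      have : (16 * ((J : ℝ) + 1) * r') ^ 2 = 256 * (J + 1) ^ 2 * r' ^ 2 := by ring
      rw [this]; gcongr
    have har : 2 * (Λ.card : ℝ) ≤ a * r' := by
      have h1 : 51200 * p * (J + 1) ^ 2 ≤ a * δ ^ 2 := by
        rwa [div_le_iff₀ (by positivity)] at ha
      have h2 : 2 * (Λ.card : ℝ) * δ ^ 2 ≤ (a * r') * δ ^ 2 := by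
        calc 2 * (Λ.card : ℝ) * δ ^ 2 ≤ 2 * (100 * p * 4 ^ j) * δ ^ 2 := by gcongr
          _ = 200 * p * (4 ^ j * δ ^ 2) := by ring
          _ ≤ 200 * p * (256 * (J + 1) ^ 2 * r') := by gcongr
          _ = 51200 * p * (J + 1) ^ 2 * r' := by ring
          _ ≤ a * δ ^ 2 * r' := by gcongr
          _ = _ := by ring
      exact le_of_mul_le_mul_right h2 (by positivity)
    have hΛw : (Λ.card : ℝ) * (2 * π * w) ≤ δ / 8 := by
      refine le_trans ?_ hwδ
      have : (4 : ℝ) ^ j ≤ 4 ^ J := pow_le_pow_right₀ (by norm_num) hjJ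
      have hpi := Real.pi_pos
      refine mul_le_mul_of_nonneg_right (hΛc.trans ?_) (by positivity)
      gcongr
    have hQ' : D * (q + 1) * Real.log 2 + Λ.card * Real.log N ≤ Q * r' := by
      have h1 : D * (q + 1) * Real.log 2 ≤ 32 / δ * (D * (q + 1) * Real.log 2) * r' := by
        have : 1 ≤ 32 / δ * r' := by
          rw [div_mul_eq_mul_div, le_div_iff₀ hδ]; linarith
        have h2 : 0 ≤ D * (q + 1) * Real.log 2 := by positivity
        calc D * (q + 1) * Real.log 2 = 1 * (D * (q + 1) * Real.log 2) := by ring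
          _ ≤ (32 / δ * r') * (D * (q + 1) * Real.log 2) := mul_le_mul_of_nonneg_right this h2
          _ = _ := by ring
      have h2 : Λ.card * Real.log N ≤ a * Real.log N * r' := by
        have hc0 : (0 : ℝ) ≤ Λ.card := Nat.cast_nonneg _
        have : (Λ.card : ℝ) ≤ a * r' := by linarith
        calc Λ.card * Real.log N ≤ (a * r') * Real.log N := mul_le_mul_of_nonneg_right this hlogN
          _ = _ := by ring
      have h3 := mul_le_mul_of_nonneg_right hQ hr'0.le
      rw [add_mul] at h3
      linarith
    have hl1 : δ * κ / (409600 * M * D ^ 2) ≤ 1 := by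
      rw [div_le_one (by positivity)]
      have : δ * κ ≤ 1 := mul_le_one₀ hδ1 hκ.le hκ1
      have : (1 : ℝ) ≤ M * D ^ 2 := one_le_mul_of_one_le_of_one_le hM0 (one_le_pow₀ hD1)
      rw [mul_assoc]
      linarith
    have hinc := increment h hρ0 hδ (by positivity : (0 : ℝ) ≤ N0) hS hdρ hDle hcov hn
      (by positivity) hl1 hw hN hN1 hWb hΛw hq har hQ'
    have hmadd : mass (S ∪ W) = mass S + mass W := Finset.sum_union hdisj
    have hmem : S ∪ W ∈ fam := by
      simp only [hfam, Finset.mem_filter, Finset.mem_univ, true_and]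
      rw [hmadd, add_div]
      exact hinc
    have := hmax _ hmem
    rw [hmadd, hWF] at this
    linarith [mul_pos hr'0 hf]

end iterate

section arith

lemma choose_J {u : ℝ} (hu : 1 ≤ u) : ∃ J : ℕ, 8 * u ≤ 2 ^ J ∧ (4 : ℝ) ^ J ≤ 256 * u ^ 2 ∧
    (J : ℝ) + 1 ≤ 8 * Real.log (2 * u) := by
  obtain ⟨n, h1, h2⟩ := exists_nat_pow_near (x := 8 * u) (y := (2 : ℝ)) (by linarith) (by norm_num)
  have hJ : (2 : ℝ) ^ (n + 1) ≤ 16 * u := by rw [pow_succ]; linarith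
  refine ⟨n + 1, h2.le, ?_, ?_⟩
  · have e : (4 : ℝ) ^ (n + 1) = (2 ^ (n + 1)) ^ 2 := by
      rw [← pow_mul, mul_comm (n + 1) 2, pow_mul]; norm_num
    rw [e]
    calc ((2 : ℝ) ^ (n + 1)) ^ 2 ≤ (16 * u) ^ 2 := pow_le_pow_left₀ (by positivity) hJ 2
      _ = _ := by ring
  · have h3 := Real.log_le_log (by positivity) hJ
    rw [Real.log_pow, show 16 * u = 2 ^ 3 * (2 * u) by ring, Real.log_mul (by norm_num) (by positivity),
      Real.log_pow] at h3
    have h4 : Real.log 2 ≤ Real.log (2 * u) := Real.log_le_log (by norm_num) (by linarith)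
    have h5 := Real.log_two_gt_d9
    push_cast at h3 ⊢
    nlinarith

lemma choose_M {p u : ℝ} (hp : 2 ≤ p) (hu : 1 ≤ u) : ∃ M : ℕ, 1 ≤ M ∧ (M : ℝ) ≤ 301 * p * u ^ 2 ∧
    ∀ k : ℕ, (k : ℝ) ≤ 100 * p * (256 * u ^ 2) + 1 → Real.exp (√(p * k)) ≤ 2 ^ M := by
  have hpu : 2 ≤ p * u ^ 2 := by nlinarith [one_le_pow₀ hu (n := 2)]
  refine ⟨⌈300 * p * u ^ 2⌉₊, ?_, ?_, ?_⟩
  · exact Nat.one_le_ceil_iff.2 (by positivity)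
  · have := Nat.ceil_lt_add_one (show 0 ≤ 300 * p * u ^ 2 by positivity)
    linarith
  · intro k hk
    have hM := Nat.le_ceil (300 * p * u ^ 2)
    set M := ⌈300 * p * u ^ 2⌉₊
    have h1 : √(p * k) ≤ 161 * p * u ^ 2 := by
      rw [Real.sqrt_le_left (by positivity)]
      have hu2 : 1 ≤ u ^ 2 := one_le_pow₀ hu
      have : (k : ℝ) ≤ 25601 * (p * u ^ 2) := by linarith
      calc p * k ≤ p * (25601 * (p * u ^ 2)) := by gcongr
        _ = 25601 * (p ^ 2 * u ^ 2) * 1 := by ring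
        _ ≤ 25921 * (p ^ 2 * u ^ 2) * u ^ 2 := by gcongr; norm_num
        _ = _ := by ring
    have h5 := Real.log_two_gt_d9
    have h2 : (2 : ℝ) ^ M = Real.exp (M * Real.log 2) := by
      rw [Real.exp_nat_mul, Real.exp_log (by norm_num)]
    rw [h2]
    refine Real.exp_le_exp.2 (h1.trans ?_)
    nlinarith

lemma choose_N {p u : ℝ} (hp : 2 ≤ p) (hu : 1 ≤ u) : ∃ N : ℕ, 1 ≤ N ∧ 4000000 * p * u ^ 3 ≤ N ∧
    (N : ℝ) ≤ 5000000 * p * u ^ 3 := by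
  have hpu : 2 ≤ p * u ^ 3 := by nlinarith [one_le_pow₀ hu (n := 3)]
  refine ⟨⌈4000000 * p * u ^ 3⌉₊, ?_, Nat.le_ceil _, ?_⟩
  · exact Nat.one_le_ceil_iff.2 (by positivity)
  · have := Nat.ceil_lt_add_one (show 0 ≤ 4000000 * p * u ^ 3 by positivity)
    linarith

lemma choose_q {x : ℝ} (hx : 1 ≤ x) : ∃ q : ℕ, x ≤ 2 ^ (q + 1) ∧
    ((q : ℝ) + 1) * Real.log 2 ≤ Real.log x + Real.log 2 := by
  obtain ⟨n, h1, h2⟩ := exists_nat_pow_near (x := x) (y := (2 : ℝ)) hx (by norm_num)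
  refine ⟨n, h2.le, ?_⟩
  have h3 := Real.log_le_log (by positivity) h1
  rw [Real.log_pow] at h3
  linarith

lemma log_N_le {p u v : ℝ} (hp : 2 ≤ p) (hu : 1 ≤ u) (hv : 1 ≤ v) {N : ℝ} (hN1 : 1 ≤ N)
    (hN : N ≤ 5000000 * p * u ^ 3) : Real.log N ≤ 15 * Real.log (2 * p * v * u) := by
  have hp0 : 0 < p := by linarith
  have hu0 : 0 < u := by linarith
  have hv0 : 0 < v := by linarith
  have h1 : Real.log N ≤ Real.log (2 ^ 23 * p * u ^ 3) := by
    refine Real.log_le_log (by linarith) (hN.trans ?_)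
    gcongr; norm_num
  rw [Real.log_mul (by positivity) (by positivity), Real.log_mul (by positivity) (by positivity),
    Real.log_pow, Real.log_pow] at h1
  rw [Real.log_mul (by positivity) (by positivity), Real.log_mul (by positivity) (by positivity),
    Real.log_mul (by positivity) (by positivity)]
  have l2 : Real.log 2 ≤ Real.log p := Real.log_le_log (by norm_num) hp
  have lu := Real.log_nonneg hu
  have lv := Real.log_nonneg hv
  have l20 : 0 < Real.log 2 := Real.log_pos (by norm_num)
  push_cast at h1
  linarith

lemma log_lam_le {p u v d x : ℝ} (hp : 2 ≤ p) (hu : 1 ≤ u) (hv : 1 ≤ v) (hd : 1 ≤ d) (hx : 1 ≤ x)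
    (h : x ≤ 409600 * (301 * p * u ^ 2) * (d + 4000000 * p * u ^ 2 * Real.log (2 * u) ^ 2) ^ 2 * u * v) :
    Real.log x ≤ 2 * Real.log (2 * v * d) + 50 * Real.log (2 * p * v * u) := by
  have hp0 : 0 < p := by linarith
  have hu0 : 0 < u := by linarith
  have hv0 : 0 < v := by linarith
  have hd0 : 0 < d := by linarith
  have hL0 : 0 ≤ Real.log (2 * u) := Real.log_nonneg (by linarith)
  have hL : Real.log (2 * u) ≤ 2 * u := by
    have := Real.log_le_sub_one_of_pos (show 0 < 2 * u by positivity); linarith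
  have hD : d + 4000000 * p * u ^ 2 * Real.log (2 * u) ^ 2 ≤ 17000000 * d * p * u ^ 4 := by
    have h1 : Real.log (2 * u) ^ 2 ≤ (2 * u) ^ 2 := pow_le_pow_left₀ hL0 hL 2
    have hpu : 1 ≤ p * u ^ 4 := by nlinarith [one_le_pow₀ hu (n := 4)]
    calc d + 4000000 * p * u ^ 2 * Real.log (2 * u) ^ 2
        ≤ d + 4000000 * p * u ^ 2 * (2 * u) ^ 2 := by gcongr
      _ = d * 1 + 1 * (16000000 * (p * u ^ 4)) := by ring
      _ ≤ d * (p * u ^ 4) + d * (16000000 * (p * u ^ 4)) := by gcongr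
      _ = 16000001 * d * p * u ^ 4 := by ring
      _ ≤ _ := by gcongr; norm_num
  have h2 : x ≤ 2 ^ 78 * p ^ 3 * u ^ 11 * v * d ^ 2 := by
    refine h.trans ?_
    calc _ ≤ 409600 * (301 * p * u ^ 2) * (17000000 * d * p * u ^ 4) ^ 2 * u * v := by gcongr
      _ = (409600 * 301 * 17000000 ^ 2) * p ^ 3 * u ^ 11 * v * d ^ 2 := by ring
      _ ≤ _ := by gcongr; norm_num
  have h1 := Real.log_le_log (by linarith) h2
  rw [Real.log_mul (by positivity) (by positivity), Real.log_mul (by positivity) (by positivity),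
    Real.log_mul (by positivity) (by positivity), Real.log_mul (by positivity) (by positivity),
    Real.log_pow, Real.log_pow, Real.log_pow, Real.log_pow] at h1
  rw [Real.log_mul (x := 2 * p * v) (by positivity) (by positivity),
    Real.log_mul (x := 2 * p) (by positivity) (by positivity),
    Real.log_mul (x := 2) (y := p) (by positivity) (by positivity),
    Real.log_mul (x := 2 * v) (by positivity) (by positivity),
    Real.log_mul (x := 2) (y := v) (by positivity) (by positivity)]
  have l2 : Real.log 2 ≤ Real.log p := Real.log_le_log (by norm_num) hp
  have lu := Real.log_nonneg hu
  have lv := Real.log_nonneg hv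
  have ld := Real.log_nonneg hd
  have l20 : 0 < Real.log 2 := Real.log_pos (by norm_num)
  push_cast at h1
  linarith

lemma final_arith {p u v d : ℝ} (hp : 2 ≤ p) (hu : 1 ≤ u) (hv : 1 ≤ v) (hd : 1 ≤ d) {t lN : ℝ}
    (ht : t ≤ 2 * Real.log (2 * v * d) + 51 * Real.log (2 * p * v * u))
    (hlN : lN ≤ 15 * Real.log (2 * p * v * u)) :
    33 * u * ((d + 4000000 * p * u ^ 2 * Real.log (2 * u) ^ 2) * t) +
      4000000 * p * u ^ 2 * Real.log (2 * u) ^ 2 * lN ≤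
    100000000000 * (u * d * Real.log (2 * v * d) + p * u ^ 3 * Real.log (2 * p * v * u) ^ 3) := by
  have hp0 : 0 < p := by linarith
  have hu0 : 0 < u := by linarith
  have hv0 : 0 < v := by linarith
  have hd0 : 0 < d := by linarith
  set L := Real.log (2 * u) with hL
  set X := Real.log (2 * v * d) with hX
  set Y := Real.log (2 * p * v * u) with hY
  have hL0 : 0 ≤ L := Real.log_nonneg (by linarith)
  have hL2 : L ≤ 2 * u := by
    have := Real.log_le_sub_one_of_pos (show 0 < 2 * u by positivity); linarith
  have hX0 : 0 ≤ X := Real.log_nonneg (by nlinarith [one_le_mul_of_one_le_of_one_le hv hd])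
  have l20 := Real.log_two_gt_d9
  have l2 : Real.log 2 ≤ Real.log p := Real.log_le_log (by norm_num) hp
  have lu := Real.log_nonneg hu
  have lv := Real.log_nonneg hv
  have eY : Y = Real.log 2 + Real.log p + Real.log v + Real.log u := by
    rw [hY, Real.log_mul (by positivity) (by positivity), Real.log_mul (by positivity) (by positivity),
      Real.log_mul (by positivity) (by positivity)]
  have eX : X = Real.log 2 + Real.log v + Real.log d := by
    rw [hX, Real.log_mul (by positivity) (by positivity), Real.log_mul (by positivity) (by positivity)]
  have eL : L = Real.log 2 + Real.log u := by
    rw [hL, Real.log_mul (by positivity) (by positivity)]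
  have hY1 : 1 ≤ Y := by linarith
  have hLY : L ≤ Y := by linarith
  have hY0 : 0 ≤ Y := by linarith
  have hYY : Y ≤ Y ^ 3 := le_self_pow₀ hY1 (by norm_num)
  have hLL : L ^ 2 ≤ Y ^ 2 := pow_le_pow_left₀ hL0 hLY 2
  have T0 : 0 ≤ p * u ^ 3 * Y ^ 3 := by positivity
  have S0 : 0 ≤ u * d * X := by positivity
  have c1 : u * d * Y ≤ u * d * X + p * u ^ 3 * Y ^ 3 := by
    rcases le_total (p * u) d with h | h
    · have : Y ≤ X := by
        refine Real.log_le_log (by positivity) ?_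
        calc 2 * p * v * u = 2 * v * (p * u) := by ring
          _ ≤ _ := by gcongr
      have : u * d * Y ≤ u * d * X := by gcongr
      linarith
    · have : u * d * Y ≤ p * u ^ 3 * Y ^ 3 := by
        calc u * d * Y ≤ u * (p * u) * Y ^ 3 := by gcongr
          _ = p * u ^ 2 * Y ^ 3 := by ring
          _ ≤ p * u ^ 3 * Y ^ 3 := by gcongr; norm_num
      linarith
  have c2 : u * (p * u ^ 2 * L ^ 2) * Y ≤ p * u ^ 3 * Y ^ 3 := by
    calc u * (p * u ^ 2 * L ^ 2) * Y ≤ u * (p * u ^ 2 * Y ^ 2) * Y := by gcongr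
      _ = _ := by ring
  have c3 : u * (p * u ^ 2 * L ^ 2) * X ≤ u * d * X + 4 * (p * u ^ 3 * Y ^ 3) := by
    rcases le_total (p * u ^ 2 * L ^ 2) d with h | h
    · have : u * (p * u ^ 2 * L ^ 2) * X ≤ u * d * X := by gcongr
      linarith
    · have hd4 : d ≤ 2 ^ 2 * p * u ^ 4 := by
        calc d ≤ p * u ^ 2 * L ^ 2 := h
          _ ≤ p * u ^ 2 * (2 * u) ^ 2 := by gcongr
          _ = _ := by ring
      have ld := Real.log_le_log hd0 hd4
      rw [Real.log_mul (by positivity) (by positivity), Real.log_mul (by positivity) (by positivity),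
        Real.log_pow, Real.log_pow] at ld
      push_cast at ld
      have hX4 : X ≤ 4 * Y := by linarith
      have : u * (p * u ^ 2 * L ^ 2) * X ≤ 4 * (p * u ^ 3 * Y ^ 3) := by
        calc u * (p * u ^ 2 * L ^ 2) * X ≤ u * (p * u ^ 2 * Y ^ 2) * (4 * Y) := by gcongr
          _ = _ := by ring
      linarith
  set b := p * u ^ 2 * L ^ 2 with hb
  have hb0 : 0 ≤ b := by positivity
  have e1 : 4000000 * p * u ^ 2 * L ^ 2 = 4000000 * b := by rw [hb]; ring
  rw [e1]
  have k1 : 33 * u * ((d + 4000000 * b) * t) ≤ 33 * u * ((d + 4000000 * b) * (2 * X + 51 * Y)) := by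
    gcongr
  have k2 : 4000000 * b * lN ≤ 4000000 * b * (15 * Y) := by gcongr
  have k3 : b * Y ≤ u * b * Y := by
    have : 0 ≤ b * Y := by positivity
    nlinarith
  have k4 : 33 * u * ((d + 4000000 * b) * (2 * X + 51 * Y)) =
      66 * (u * d * X) + 1683 * (u * d * Y) + 264000000 * (u * b * X) + 6732000000 * (u * b * Y) := by
    ring
  linarith

end arith

section final

lemma wiener_nonneg {G : Type} [AddCommGroup G] [Fintype G] (f : G → ℂ) : 0 ≤ wienerNorm f := by
  rw [wiener_eq]; exact Finset.sum_nonneg fun γ _ => norm_nonneg _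

lemma wiener_zero {G : Type} [AddCommGroup G] [Fintype G] {f : G → ℂ} (h : wienerNorm f = 0) :
    f = 0 := by
  rw [wiener_eq, Finset.sum_eq_zero_iff_of_nonneg fun γ _ => norm_nonneg _] at h
  funext x
  rw [fourier_inversion f x]
  refine Finset.sum_eq_zero fun γ hγ => ?_
  rw [norm_eq_zero.1 (h γ hγ), zero_mul]

set_option maxHeartbeats 4000000 in
lemma main_pos (G : Type) [AddCommGroup G] [Fintype G]
    (A : Set G) (B : BohrSystem G) (d : ℝ) (f : G → ℂ) (δ κ p : ℝ)
    (hd : 1 ≤ d) (hdim : B.dim ≤ d) (hδ : 0 < δ) (hδ1 : δ ≤ 1) (hκ : 0 < κ) (hκ1 : κ ≤ 1)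
    (hp : 2 ≤ p) (hf : 0 < wienerNorm f) :
    ∃ B' : BohrSystem G, B'.le B ∧
      ((dCoveringNumber A (B'.sets 1) : ℝ≥0∞) ≤
        ENNReal.ofReal (Real.exp (100000000000 * (δ⁻¹ * d * Real.log (2 * κ⁻¹ * d) +
            p * δ⁻¹ ^ 3 * Real.log (2 * p * κ⁻¹ * δ⁻¹) ^ 3))) *
          (dCoveringNumber A (B.sets 1) : ℝ≥0∞)) ∧
      B'.dim ≤ d + 100000000000 * p * δ⁻¹ ^ 2 * Real.log (2 * δ⁻¹) ^ 2 ∧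
      ∃ μ ν : G → ℝ, IsProb μ ∧ ApproxInvariant B'.sets μ ∧ IsProb ν ∧
        (∀ y : G, ν y ≠ 0 → y ∈ B'.sets κ) ∧
        ∀ x : G,
          LpW p (fun y => ν (y - x)) (fun y => f y - convC f μ y) ≤ δ * wienerNorm f := by
  classical
  obtain ⟨ρ0, h0, hB⟩ := exists_BN B
  have hdim0 := dimLE_of_system B h0 hB hdim
  have hB1 : B.sets 1 = {x | ρ0 x < 1} := hB 1 one_pos le_rfl
  have h01 : (0 : G) ∈ B.sets 1 := by rw [hB1]; simp [h0.zero]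
  have hfin : dCoveringNumber A (B.sets 1) ≠ ⊤ :=
    ne_top_of_le_ne_top (ENat.natCast_ne_top _) (isCov_finite (S := A) h01).dCov_le
  obtain ⟨N0, hN0⟩ := ENat.ne_top_iff_exists.1 hfin
  have hcov0 : IsCov A {x | ρ0 x < 1} N0 := by
    rw [← hB1]; exact isCov_of_dCov_le hN0.symm.le
  set u := δ⁻¹ with hu
  set v := κ⁻¹ with hv
  have hu1 : 1 ≤ u := (one_le_inv₀ hδ).2 hδ1
  have hv1 : 1 ≤ v := (one_le_inv₀ hκ).2 hκ1
  have hδu : δ = u⁻¹ := by rw [hu, inv_inv]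
  have hκv : κ = v⁻¹ := by rw [hv, inv_inv]
  have hu0 : 0 < u := by linarith
  have hv0 : 0 < v := by linarith
  have hp0 : 0 < p := by linarith
  set L := Real.log (2 * u) with hL
  have hL0 : 0 ≤ L := Real.log_nonneg (by linarith)
  set a : ℝ := 4000000 * p * u ^ 2 * L ^ 2 with ha
  have ha0 : 0 ≤ a := by positivity
  set D : ℝ := d + a with hD
  have hD1 : 1 ≤ D := by linarith
  have hD0 : 0 < D := by linarith
  obtain ⟨J, hJ1, hJ2, hJ3⟩ := choose_J hu1
  obtain ⟨M, hM1, hM2, hM3⟩ := choose_M hp hu1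
  obtain ⟨N, hN1, hN2, hN3⟩ := choose_N hp hu1
  have hM1' : (1 : ℝ) ≤ M := by exact_mod_cast hM1
  have hM0 : (0 : ℝ) < M := by linarith
  set x : ℝ := 409600 * M * D ^ 2 * u * v with hx
  have hx1 : 1 ≤ x := by
    have h2 : (1 : ℝ) ≤ 409600 * M := by linarith
    exact one_le_mul_of_one_le_of_one_le (one_le_mul_of_one_le_of_one_le
      (one_le_mul_of_one_le_of_one_le h2 (one_le_pow₀ hD1)) hu1) hv1
  obtain ⟨q, hq1, hq2⟩ := choose_q hx1
  have hxl : δ * κ / (409600 * M * D ^ 2) = x⁻¹ := by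
    rw [hx, hδu, hκv]; field_simp
  have hqx : (1 / 2 : ℝ) ^ (q + 1) ≤ δ * κ / (409600 * M * D ^ 2) := by
    rw [hxl, one_div, inv_pow]
    exact inv_anti₀ (by linarith) hq1
  have hlogx : Real.log x ≤ 2 * Real.log (2 * v * d) + 50 * Real.log (2 * p * v * u) := by
    refine log_lam_le hp hu1 hv1 hd hx1 ?_
    rw [hx, hD, ha, hL]
    have : 0 ≤ (d + 4000000 * p * u ^ 2 * Real.log (2 * u) ^ 2) ^ 2 := by positivity
    gcongr
  have hlogN := log_N_le hp hu1 hv1 (N := N) (by exact_mod_cast hN1) hN3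
  have hl2Y : Real.log 2 ≤ Real.log (2 * p * v * u) := by
    refine Real.log_le_log (by norm_num) ?_
    have := one_le_mul_of_one_le_of_one_le (one_le_mul_of_one_le_of_one_le
      (show 1 ≤ p by linarith) hv1) hu1
    calc (2 : ℝ) ≤ 2 * (p * v * u) := by linarith
      _ = _ := by ring
  have hfa := final_arith hp hu1 hv1 hd (t := ((q : ℝ) + 1) * Real.log 2) (lN := Real.log N)
    (by linarith) hlogN
  rw [← hL, ← ha, ← hD] at hfa
  set w : ℝ := (2000000 * p * u ^ 3)⁻¹ with hw
  set Q : ℝ := 32 / δ * (D * (q + 1) * Real.log 2) + a * Real.log N with hQ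
  obtain ⟨ρ, h, hle, hdρ, ⟨n, hcov, hn⟩, μ, ν, hμ, hμi, hν, hνs, hfinal⟩ :=
    iterate h0 hd hdim0 hcov0 f hδ hδ1 hκ hκ1 hp hf (M := M) (J := J) (N := N) (q := q) (a := a)
      (w := w) (Q := Q) (D := D) hM1
      (by
        rw [one_div, inv_pow, hδu, show u⁻¹ / 8 = (8 * u)⁻¹ by field_simp]
        exact inv_anti₀ (by positivity) hJ1)
      (fun k hk => hM3 k (hk.trans (by gcongr)))
      (by
        have h1 : ((J : ℝ) + 1) ^ 2 ≤ (8 * L) ^ 2 := pow_le_pow_left₀ (by positivity) hJ3 2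
        rw [hδu, div_eq_mul_inv, inv_pow, inv_inv, ha]
        calc 51200 * p * ((J : ℝ) + 1) ^ 2 * u ^ 2 ≤ 51200 * p * (8 * L) ^ 2 * u ^ 2 := by gcongr
          _ = 3276800 * p * u ^ 2 * L ^ 2 := by ring
          _ ≤ _ := by gcongr; norm_num)
      rfl (by positivity)
      (by
        rw [hw, ← div_eq_mul_inv, le_div_iff₀ (by positivity)]
        linarith)
      hN1
      (by
        have hpi : π ≤ 3.15 := Real.pi_lt_d2.le
        have hpi0 := Real.pi_pos
        have h1 : 100 * p * 4 ^ J * (2 * π * w) ≤ 100 * p * (256 * u ^ 2) * (2 * 3.15 * w) := by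
          have : 0 < w := by positivity
          gcongr
        refine h1.trans ?_
        rw [hw, hδu]
        have e : 100 * p * (256 * u ^ 2) * (2 * 3.15 * (2000000 * p * u ^ 3)⁻¹) =
            (25600 * 6.3 / 2000000) * u⁻¹ := by
          field_simp; norm_num
        rw [e]
        have : 0 < u⁻¹ := by positivity
        have e2 : (25600 * 6.3 / 2000000 : ℝ) ≤ 1 / 8 := by norm_num
        nlinarith)
      hqx le_rfl
  set s : ℝ := 1 / (80 * D) with hs
  have hs0 : 0 < s := by positivity
  have hs1 : s ≤ 1 := by rw [hs, div_le_one (by positivity)]; linarith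
  have hle1 : ∀ x, ρ0 x ≤ ρ x / s := fun x => by
    refine (hle x).trans ?_
    rw [le_div_iff₀ hs0]; nlinarith [h.nonneg x]
  have hmem : ∀ η y, ρ y < η / (80 * D) ↔ ρ y / s < η := fun η y => by
    rw [div_lt_iff₀ hs0, hs, mul_one_div]
  refine ⟨(h.scale hs0).system, ?_, ?_, ?_, μ, ν, hμ, ?_, hν, ?_, hfinal⟩
  · intro η hη0 hη1 y hy
    rw [hB η hη0 hη1]
    exact (hle1 y).trans_lt hy
  · obtain ⟨n1, hn1, hc1⟩ := hdρ.iter q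
    have hc2 : IsCov A {y | ρ y / s < 1} (n * n1) := by
      refine (hcov.trans hc1).mono subset_rfl ?_ le_rfl
      intro y hy
      change ρ y / s < 1
      rw [div_lt_one hs0]
      refine lt_of_lt_of_le hy (hqx.trans ?_)
      rw [hs, div_le_div_iff₀ (by positivity) (by positivity)]
      have h1 : δ * κ ≤ 1 := mul_le_one₀ hδ1 hκ.le hκ1
      have h2 : D ≤ D ^ 2 := le_self_pow₀ hD1 (by norm_num)
      calc δ * κ * (80 * D) ≤ 1 * (80 * D ^ 2) := by gcongr
        _ ≤ 1 * (409600 * M * D ^ 2) := by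
          have : 0 ≤ D ^ 2 := by positivity
          have : (80 : ℝ) ≤ 409600 * M := by linarith
          gcongr
    have hbound : ((n * n1 : ℕ) : ℝ) ≤ Real.exp (100000000000 * (u * d * Real.log (2 * v * d) +
        p * u ^ 3 * Real.log (2 * p * v * u) ^ 3)) * N0 := by
      have e1 : ((2 : ℝ) ^ D) ^ (q + 1) = Real.exp (D * (q + 1) * Real.log 2) := by
        rw [Real.rpow_def_of_pos (by norm_num), ← Real.exp_nat_mul]; push_cast; ring_nf
      push_cast
      calc (n : ℝ) * n1 ≤ (Real.exp Q * N0) * Real.exp (D * (q + 1) * Real.log 2) := by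
            rw [e1] at hn1; gcongr
        _ = Real.exp (Q + D * (q + 1) * Real.log 2) * N0 := by
            rw [show Real.exp (Q + D * (q + 1) * Real.log 2) = Real.exp Q * Real.exp (D * (q + 1) * Real.log 2) from Real.exp_add Q _, mul_right_comm]
        _ ≤ _ := by
            refine mul_le_mul_of_nonneg_right (Real.exp_le_exp.2 (le_trans ?_ hfa)) (by positivity)
            rw [hQ, div_eq_mul_inv, ← hu]
            have hl2 : 0 < Real.log 2 := Real.log_pos (by norm_num)
            have : 0 ≤ D * ((q + 1) * Real.log 2) := by positivity
            nlinarith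
    have h3 : (dCoveringNumber A ((h.scale hs0).system.sets 1) : ℝ≥0∞) ≤ ((n * n1 : ℕ) : ℝ≥0∞) := by
      exact_mod_cast hc2.dCov_le
    rw [← hN0]
    refine h3.trans ?_
    have e4 : (((N0 : ℕ∞)) : ℝ≥0∞) = ENNReal.ofReal (N0 : ℝ) := by
      rw [ENNReal.ofReal_natCast]; simp
    rw [e4, ← ENNReal.ofReal_mul (Real.exp_pos _).le, ← ENNReal.ofReal_natCast]
    exact ENNReal.ofReal_le_ofReal hbound
  · refine ((h.scale hs0).system_dim hD0.le (hdρ.scale hs0 hs1)).trans ?_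
    rw [hD, ha]
    gcongr
    norm_num
  · refine hμi.mono ?_
    intro η _ _ y hy
    exact (hmem η y).2 hy
  · intro y hy
    exact (hmem κ y).1 (hνs y hy)

end final

/-- Proposition 7.1, quantitative continuity. -/
theorem statement3 :
    ∃ C : ℝ, 0 < C ∧
      ∀ (G : Type) [AddCommGroup G] [Fintype G],
        ∀ (A : Set G) (B : BohrSystem G) (d : ℝ) (f : G → ℂ) (δ κ p : ℝ),
          1 ≤ d → B.dim ≤ d → 0 < δ → δ ≤ 1 → 0 < κ → κ ≤ 1 → 2 ≤ p →
          ∃ B' : BohrSystem G, B'.le B ∧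
            ((dCoveringNumber A (B'.sets 1) : ℝ≥0∞) ≤
              ENNReal.ofReal (Real.exp (C * (δ⁻¹ * d * Real.log (2 * κ⁻¹ * d) +
                  p * δ⁻¹ ^ 3 * Real.log (2 * p * κ⁻¹ * δ⁻¹) ^ 3))) *
                (dCoveringNumber A (B.sets 1) : ℝ≥0∞)) ∧
            B'.dim ≤ d + C * p * δ⁻¹ ^ 2 * Real.log (2 * δ⁻¹) ^ 2 ∧
            ∃ μ ν : G → ℝ, IsProb μ ∧ ApproxInvariant B'.sets μ ∧ IsProb ν ∧
              (∀ y : G, ν y ≠ 0 → y ∈ B'.sets κ) ∧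
              ∀ x : G,
                LpW p (fun y => ν (y - x)) (fun y => f y - convC f μ y) ≤ δ * wienerNorm f := by
  refine ⟨100000000000, by norm_num, ?_⟩
  intro G _ _ A B d f δ κ p hd hdim hδ hδ1 hκ hκ1 hp
  rcases (wiener_nonneg f).eq_or_lt with hf | hf
  · have hf0 : f = 0 := wiener_zero hf.symm
    have h1 : 0 < wienerNorm (fun _ : G => (1 : ℂ)) := by
      rcases (wiener_nonneg (fun _ : G => (1 : ℂ))).eq_or_lt with h | h
      · have := congrFun (wiener_zero h.symm) 0
        simp at this
      · exact h
    obtain ⟨B', b1, b2, b3, μ, ν, c1, c2, c3, c4, -⟩ :=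
      main_pos G A B d (fun _ => 1) δ κ p hd hdim hδ hδ1 hκ hκ1 hp h1
    refine ⟨B', b1, b2, b3, μ, ν, c1, c2, c3, c4, fun x => ?_⟩
    have hp0 : p ≠ 0 := by linarith
    rw [← hf, hf0]
    simp [LpW, convC, Real.zero_rpow hp0, Real.zero_rpow (inv_ne_zero hp0)]
  · exact main_pos G A B d f δ κ p hd hdim hδ hδ1 hκ hκ1 hp hf

end Paper
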